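/- Fix q₀ > 0 and M > 0. There exists C > 0, depending only on n, Ω, A, q₀ and M, with the following property. Let q, q̃ : closure(Ω) → ℝ be Lipschitz with q ≥ q₀, q̃ ≥ q₀, ‖q‖_{W^{1,∞}} ≤ M, ‖q̃‖_{W^{1,∞}} ≤ M and q = q̃ on ∂Ω. Let u, ũ ∈ C²(Ω) ∩ C¹(closure(Ω)) be classical solutions of L_q u = 0 and L_{q̃} ũ = 0 with u = ũ on ∂Ω, ‖u‖_{C¹(closure(Ω))} ≤ M and ‖ũ‖_{C¹(closure(Ω))} ≤ M. Set √I_q := √q·|u| and √I_{q̃} := √q̃·|ũ|. Then ‖u² − ũ²‖_{H¹(Ω)} ≤ C ‖√I_q − √I_{q̃}‖_{H¹(Ω)}^{1/2}. -/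

import Mathlib

open MeasureTheory Metric Set
open scoped RealInnerProductSpace

noncomputable section

/-- The `i`-th partial derivative of a real-valued function on `ℝⁿ`. -/
noncomputable def pd {n : ℕ} (i : Fin n) (f : EuclideanSpace ℝ (Fin n) → ℝ)
    (x : EuclideanSpace ℝ (Fin n)) : ℝ :=
  fderiv ℝ f x (EuclideanSpace.single i 1)

/-- `u` is a classical solution of `L_q u = ∑ᵢⱼ ∂ᵢ (aⁱʲ ∂ⱼ u) + q u = 0` pointwise in `Ω`. -/
def IsSolution {n : ℕ} (A : Fin n → Fin n → EuclideanSpace ℝ (Fin n) → ℝ)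
    (q u : EuclideanSpace ℝ (Fin n) → ℝ) (Ω : Set (EuclideanSpace ℝ (Fin n))) : Prop :=
  ∀ x ∈ Ω, (∑ i, ∑ j, pd i (fun y => A i j y * pd j u y) x) + q x * u x = 0

/-- The `H¹(D)` norm `(∫_D (w² + ‖∇w‖²))^{1/2}`. -/
noncomputable def H1Norm {n : ℕ} (D : Set (EuclideanSpace ℝ (Fin n)))
    (w : EuclideanSpace ℝ (Fin n) → ℝ) : ℝ :=
  (∫ x in D, ((w x) ^ 2 + ‖fderiv ℝ w x‖ ^ 2)) ^ (1 / 2 : ℝ)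

/-- `A = (aⁱʲ)` is symmetric, has `C¹` entries on `closure Ω`, and is uniformly elliptic. -/
def EllipticSym {n : ℕ} (Ω : Set (EuclideanSpace ℝ (Fin n)))
    (A : Fin n → Fin n → EuclideanSpace ℝ (Fin n) → ℝ) : Prop :=
  (∀ i j, ∀ x ∈ closure Ω, A i j x = A j i x) ∧
  (∀ i j, ContDiffOn ℝ 1 (A i j) (closure Ω)) ∧
  (∃ lam > 0, ∀ x ∈ Ω, ∀ ξ : EuclideanSpace ℝ (Fin n),
    lam * ‖ξ‖ ^ 2 ≤ ∑ i, ∑ j, A i j x * ξ i * ξ j)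

/-- `‖f‖_{W^{1,∞}(closure Ω)} = sup |f| + Lip(f) ≤ M`. -/
def W1InfBound {n : ℕ} (Ω : Set (EuclideanSpace ℝ (Fin n)))
    (f : EuclideanSpace ℝ (Fin n) → ℝ) (M : ℝ) : Prop :=
  ∃ K : NNReal, LipschitzOnWith K f (closure Ω) ∧ ∀ x ∈ closure Ω, |f x| + (K : ℝ) ≤ M

/-- `∂Ω` is of class `C^{1,1}`: near each boundary point, after choosing a direction `ν`,
`Ω` is the region on one side of the graph of a function with Lipschitz derivative. -/
def IsC11Boundary {n : ℕ} (Ω : Set (EuclideanSpace ℝ (Fin n))) : Prop :=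
  ∀ x ∈ frontier Ω, ∃ r > 0, ∃ ν : EuclideanSpace ℝ (Fin n), ‖ν‖ = 1 ∧
    ∃ φ : EuclideanSpace ℝ (Fin n) → ℝ, ∃ K : NNReal,
      Differentiable ℝ φ ∧ LipschitzWith K (fderiv ℝ φ) ∧
      ∀ y ∈ ball x r, (y ∈ Ω ↔ ⟪y, ν⟫ < φ (y - ⟪y, ν⟫ • ν))


theorem four_sq (a b c d : ℝ) : (a+b+c+d)^2 ≤ 4*(a^2+b^2+c^2+d^2) := by
  linarith [sq_nonneg (a-b), sq_nonneg (a-c), sq_nonneg (a-d), sq_nonneg (b-c), sq_nonneg (b-d),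
    sq_nonneg (c-d)]

theorem pw_R {V : Type*} [NormedAddCommGroup V] [NormedSpace ℝ V] (B : V →ₗ[ℝ] V →ₗ[ℝ] ℝ)
    (hs : ∀ x y, B x y = B y x) (U Ut r k qt : ℝ) (U' Ut' r' : V) (hk : k * r = 1)  :
    (B (Ut • (k^2 • r') + (1 - k) • Ut') Ut' - qt * Ut^2 * (1 - k))
    - (B (U • ((2*r-1) • r') + (r^2 - r) • U') U' - (r^2 * qt) * U^2 * (r^2 - r)) =
    U^2 * B r' r' + qt * r * U^2 * (r-1)^2 * (r+1) +
    ((1-k) * (B (Ut' - r • U' - U • r') Ut' + B (r • U' + U • r') (Ut' - r • U' - U • r'))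
     + (Ut - r * U) * B (k^2 • r') Ut' + (r * U) * B (k^2 • r') (Ut' - r • U' - U • r')
     - qt * (1-k) * (2 * (r*U) * (Ut - r*U) + (Ut - r*U)^2)) := by
  simp only [map_add, map_sub, map_smul, LinearMap.add_apply, LinearMap.sub_apply,
    LinearMap.smul_apply, smul_eq_mul]
  rw [hs U' r']
  have hr : r ≠ 0 := by rintro rfl; simp at hk
  have : k = 1 / r := by field_simp; linarith
  subst this
  field_simp
  ring

theorem pw_Rbound {V : Type*} [NormedAddCommGroup V] [NormedSpace ℝ V] (B : V →ₗ[ℝ] V →ₗ[ℝ] ℝ)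
    (K : ℝ) (hK : 1 ≤ K) (hB : ∀ x y, |B x y| ≤ K * ‖x‖ * ‖y‖)
    (Y e k qt : ℝ) (Y' e' Ut' r' : V)
    (hY : |Y| ≤ K^2) (he : |e| ≤ 2*K^2) (hk : |k| ≤ K) (hqt : |qt| ≤ K)
    (hY' : ‖Y'‖ ≤ 2*K^2) (hUt' : ‖Ut'‖ ≤ K) (hr' : ‖r'‖ ≤ K) :
    |(1-k) * (B e' Ut' + B Y' e')
     + e * B (k^2 • r') Ut' + Y * B (k^2 • r') e'
     - qt * (1-k) * (2 * Y * e + e^2)| ≤ 20 * K^6 * (|e| + ‖e'‖) := by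
  have hK0 : 0 ≤ K := by linarith
  have pw : ∀ m ≤ 6, K^m ≤ K^6 := fun m hm => pow_le_pow_right₀ hK hm
  have h1k : |1 - k| ≤ 2*K := by
    have := abs_sub (1:ℝ) k
    simp at this; linarith
  have a1 : |B e' Ut'| ≤ K^2 * ‖e'‖ := by
    refine (hB _ _).trans ?_
    calc K * ‖e'‖ * ‖Ut'‖ ≤ K * ‖e'‖ * K := by gcongr
      _ = _ := by ring
  have a2 : |B Y' e'| ≤ 2*K^3 * ‖e'‖ := by
    refine (hB _ _).trans ?_
    calc K * ‖Y'‖ * ‖e'‖ ≤ K * (2*K^2) * ‖e'‖ := by gcongr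
      _ = _ := by ring
  have n1 : ‖k^2 • r'‖ ≤ K^3 := by
    rw [norm_smul, norm_pow, Real.norm_eq_abs]
    calc |k|^2 * ‖r'‖ ≤ K^2 * K := by gcongr
      _ = _ := by ring
  have a3 : |B (k^2 • r') Ut'| ≤ K^5 := by
    refine (hB _ _).trans ?_
    calc K * ‖k^2 • r'‖ * ‖Ut'‖ ≤ K * K^3 * K := by gcongr
      _ = _ := by ring
  have a4 : |B (k^2 • r') e'| ≤ K^4 * ‖e'‖ := by
    refine (hB _ _).trans ?_
    calc K * ‖k^2 • r'‖ * ‖e'‖ ≤ K * K^3 * ‖e'‖ := by gcongr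
      _ = _ := by ring
  have b1 : |(1-k) * (B e' Ut' + B Y' e')| ≤ 6*K^4 * ‖e'‖ := by
    rw [abs_mul]
    calc |1-k| * |B e' Ut' + B Y' e'| ≤ (2*K) * (K^2 * ‖e'‖ + 2*K^3 * ‖e'‖) := by
          gcongr; exact (abs_add_le _ _).trans (add_le_add a1 a2)
      _ ≤ (2*K) * (K^3 * ‖e'‖ + 2*K^3 * ‖e'‖) := by
          gcongr; norm_num
      _ = _ := by ring
  have b2 : |e * B (k^2 • r') Ut'| ≤ K^5 * |e| := by
    rw [abs_mul, mul_comm]; gcongr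
  have b3 : |Y * B (k^2 • r') e'| ≤ K^6 * ‖e'‖ := by
    rw [abs_mul]
    calc |Y| * |B (k^2 • r') e'| ≤ K^2 * (K^4 * ‖e'‖) := by gcongr
      _ = _ := by ring
  have b4 : |qt * (1-k) * (2 * Y * e + e^2)| ≤ 8*K^4 * |e| := by
    have : 2 * Y * e + e^2 = (2 * Y + e) * e := by ring
    rw [this, abs_mul, abs_mul, abs_mul]
    have h2 : |2*Y + e| ≤ 4*K^2 := by
      have := abs_add_le (2*Y) e
      rw [abs_mul, abs_two] at this; linarith
    calc |qt| * |1-k| * (|2*Y+e| * |e|) ≤ K * (2*K) * ((4*K^2) * |e|) := by gcongr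
      _ = _ := by ring
  have c1 : K^4 * ‖e'‖ ≤ K^6 * ‖e'‖ := by gcongr; norm_num
  have c2 : K^5 * |e| ≤ K^6 * |e| := by gcongr; norm_num
  have c3 : K^4 * |e| ≤ K^6 * |e| := by gcongr; norm_num
  have p1 : 0 ≤ K^6 * |e| := by positivity
  have p2 : 0 ≤ K^6 * ‖e'‖ := by positivity
  have t := abs_sub ((1-k) * (B e' Ut' + B Y' e')
     + e * B (k^2 • r') Ut' + Y * B (k^2 • r') e') (qt * (1-k) * (2 * Y * e + e^2))
  have t2 := abs_add_le ((1-k) * (B e' Ut' + B Y' e')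
     + e * B (k^2 • r') Ut') (Y * B (k^2 • r') e')
  have t3 := abs_add_le ((1-k) * (B e' Ut' + B Y' e')) (e * B (k^2 • r') Ut')
  nlinarith

theorem pw_W {V : Type*} [NormedAddCommGroup V] [NormedSpace ℝ V] 
    (K : ℝ) (hK : 1 ≤ K) (U Ut r : ℝ) (U' Ut' r' : V)
    (hU : |U| ≤ K) (hUt : |Ut| ≤ K) (hr0 : 0 ≤ r) (hr : r ≤ K) (hU' : ‖U'‖ ≤ K) (hUt' : ‖Ut'‖ ≤ K)
    (hr' : ‖r'‖ ≤ K) :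
    (U^2 - Ut^2)^2 + ‖(2*U) • U' - (2*Ut) • Ut'‖^2 ≤
      200 * K^6 * (U^2 * ‖r'‖^2 + U^2 * (r-1)^2 + |Ut - r * U| + ‖Ut' - r • U' - U • r'‖) := by
  have hK0 : 0 ≤ K := by linarith
  set e := Ut - r * U with he
  set e' := Ut' - r • U' - U • r' with he'
  have hY : |r * U| ≤ K^2 := by
    rw [abs_mul, abs_of_nonneg hr0]
    calc r * |U| ≤ K * K := by gcongr
      _ = _ := by ring
  have heb : |e| ≤ 2*K^2 := by
    have := abs_sub Ut (r*U)
    nlinarith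
  have heb' : ‖e'‖ ≤ 3*K^2 := by
    have h1 := norm_sub_le (Ut' - r • U') (U • r')
    have h2 := norm_sub_le (Ut') (r • U')
    rw [norm_smul, Real.norm_eq_abs] at h1 h2
    rw [abs_of_nonneg hr0] at h2
    have h3 : r * ‖U'‖ ≤ K * K := by gcongr
    have h4 : |U| * ‖r'‖ ≤ K * K := by gcongr
    have : ‖e'‖ = ‖Ut' - r • U' - U • r'‖ := rfl
    nlinarith
  have hT : 0 ≤ U^2 * (r-1)^2 := by positivity
  have hS : 0 ≤ U^2 * ‖r'‖^2 := by positivity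
  set T := U^2 * (r-1)^2 with hTd
  set S := U^2 * ‖r'‖^2 with hSd
  have r1 : r + 1 ≤ 2*K := by linarith
  have hUsq : U^2 ≤ K^2 := by rw [← sq_abs]; gcongr
  have c1 : K^4 ≤ K^6 := pow_le_pow_right₀ hK (by norm_num)
  have w1 : (U^2 - Ut^2)^2 ≤ 8*K^4 * T + 64*K^6*|e| := by
    have e1 : U^2 - Ut^2 = -(U * (r+1)) * (U*(r-1)) - (e + 2*(r*U)) * e := by rw [he]; ring
    have f1 : (U * (r+1))^2 ≤ 4*K^4 := by
      rw [mul_pow]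
      calc U^2 * (r+1)^2 ≤ K^2 * (2*K)^2 := by gcongr
        _ = _ := by ring
    have f2 : |e + 2*(r*U)| ≤ 4*K^2 := by
      have := abs_add_le e (2*(r*U))
      rw [abs_mul (2:ℝ), abs_two] at this
      linarith
    have f3 : ((e + 2*(r*U)) * e)^2 ≤ 32*K^6*|e| := by
      rw [mul_pow, ← sq_abs, ← sq_abs e]
      calc |e + 2*(r*U)|^2 * |e|^2 = |e + 2*(r*U)|^2 * (|e| * |e|) := by ring
        _ ≤ (4*K^2)^2 * ((2*K^2) * |e|) := by gcongr
        _ = 32*K^6*|e| := by ring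
    rw [e1]
    have f4 : (U * (r+1))^2 * T ≤ 4*K^4 * T := by gcongr
    have f5 : (-(U * (r+1)) * (U*(r-1)))^2 = (U * (r+1))^2 * T := by rw [hTd]; ring
    have f6 := sq_nonneg (-(U * (r+1)) * (U*(r-1)) + (e + 2*(r*U)) * e)
    nlinarith
  have w2 : ‖(2*U) • U' - (2*Ut) • Ut'‖^2 ≤ 4*(16*K^4*T + 4*K^4*S + 8*K^4*|e| + 12*K^6*‖e'‖) := by
    have id1 : (2*U) • U' - (2*Ut) • Ut' =
       (2*(1-r^2)*U) • U' - (2*r*U^2) • r' - (2*e) • Ut' - (2*(r*U)) • e' := by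
      rw [he, he']; module
    have i1 : ‖(2*(1-r^2)*U) • U'‖ ≤ 4*K^2*(|r-1| * |U|) := by
      have : 2*(1-r^2)*U = -(2*(r+1)*((r-1)*U)) := by ring
      rw [norm_smul, Real.norm_eq_abs, this, abs_neg, abs_mul, abs_mul, abs_mul, abs_two, abs_of_nonneg (by linarith : 0 ≤ r+1)]
      calc 2*(r+1)*(|r-1| * |U|)*‖U'‖ ≤ 2*(2*K)*(|r-1| * |U|)*K := by gcongr
        _ = _ := by ring
    have i2 : ‖(2*r*U^2) • r'‖ ≤ 2*K^2*(|U| * ‖r'‖) := by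
      rw [norm_smul, Real.norm_eq_abs, abs_mul, abs_mul, abs_two, abs_of_nonneg hr0, abs_pow]
      calc 2*r*|U|^2*‖r'‖ = 2*r*|U| * (|U| * ‖r'‖) := by ring
        _ ≤ 2*K*K*(|U| * ‖r'‖) := by gcongr
        _ = _ := by ring
    have i3 : ‖(2*e) • Ut'‖ ≤ 2*K*|e| := by
      rw [norm_smul, Real.norm_eq_abs, abs_mul, abs_two]
      calc 2*|e| * ‖Ut'‖ ≤ 2*|e| * K := by gcongr
        _ = _ := by ring
    have i4 : ‖(2*(r*U)) • e'‖ ≤ 2*K^2*‖e'‖ := by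
      rw [norm_smul, Real.norm_eq_abs, abs_mul, abs_two]
      gcongr
    have j : ‖(2*U) • U' - (2*Ut) • Ut'‖ ≤ 4*K^2*(|r-1| * |U|) + 2*K^2*(|U| * ‖r'‖) + 2*K*|e| + 2*K^2*‖e'‖ := by
      rw [id1]
      have t1 := norm_sub_le ((2*(1-r^2)*U) • U' - (2*r*U^2) • r' - (2*e) • Ut') ((2*(r*U)) • e')
      have t2 := norm_sub_le ((2*(1-r^2)*U) • U' - (2*r*U^2) • r') ((2*e) • Ut')
      have t3 := norm_sub_le ((2*(1-r^2)*U) • U') ((2*r*U^2) • r')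
      linarith
    have m1 : (4*K^2*(|r-1| * |U|))^2 = 16*K^4*T := by
      rw [hTd, mul_pow, mul_pow, mul_pow, sq_abs, sq_abs]; ring
    have m2 : (2*K^2*(|U| * ‖r'‖))^2 = 4*K^4*S := by
      rw [hSd, mul_pow, mul_pow, mul_pow, sq_abs]; ring
    have m3 : (2*K*|e|)^2 ≤ 8*K^4*|e| := by
      calc (2*K*|e|)^2 = 4*K^2*(|e| * |e|) := by ring
        _ ≤ 4*K^2*((2*K^2)*|e|) := by gcongr
        _ = _ := by ring
    have m4 : (2*K^2*‖e'‖)^2 ≤ 12*K^6*‖e'‖ := by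
      calc (2*K^2*‖e'‖)^2 = 4*K^4*(‖e'‖*‖e'‖) := by ring
        _ ≤ 4*K^4*((3*K^2)*‖e'‖) := by gcongr
        _ = _ := by ring
    calc ‖(2*U) • U' - (2*Ut) • Ut'‖^2 ≤ (4*K^2*(|r-1| * |U|) + 2*K^2*(|U| * ‖r'‖) + 2*K*|e| + 2*K^2*‖e'‖)^2 := by gcongr
      _ ≤ _ := four_sq _ _ _ _
      _ ≤ _ := by linarith
  have z1 : K^4 * T ≤ K^6 * T := by gcongr
  have z2 : K^4 * S ≤ K^6 * S := by gcongr
  have z3 : K^4 * |e| ≤ K^6 * |e| := by gcongr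
  have y1 : 0 ≤ K^6 * T := by positivity
  have y2 : 0 ≤ K^6 * S := by positivity
  have y3 : 0 ≤ K^6 * |e| := by positivity
  have y4 : 0 ≤ K^6 * ‖e'‖ := by positivity
  linarith

/-- The pointwise algebraic inequality behind the stability estimate. -/
theorem pw_main {V : Type*} [NormedAddCommGroup V] [NormedSpace ℝ V] (lam K : ℝ) (hlam : 0 < lam)
    (hK : 1 ≤ K) : ∃ N > 0, ∃ C > 0, ∀ (B : V →ₗ[ℝ] V →ₗ[ℝ] ℝ) (U Ut r k qt : ℝ) (U' Ut' r' : V),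
    (∀ x y, B x y = B y x) → (∀ x y, |B x y| ≤ K * ‖x‖ * ‖y‖) → (∀ x, lam * ‖x‖^2 ≤ B x x) →
    k * r = 1 → 0 ≤ r → r ≤ K → |k| ≤ K → |qt| ≤ K → 1 ≤ K * qt →
    |U| ≤ K → |Ut| ≤ K → ‖U'‖ ≤ K → ‖Ut'‖ ≤ K → ‖r'‖ ≤ K →
    (U^2 - Ut^2)^2 + ‖(2*U) • U' - (2*Ut) • Ut'‖^2 ≤
      N * ((B (Ut • (k^2 • r') + (1 - k) • Ut') Ut' - qt * Ut^2 * (1 - k))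
        - (B (U • ((2*r-1) • r') + (r^2 - r) • U') U' - (r^2 * qt) * U^2 * (r^2 - r)))
      + C * (|Ut - r * U| + ‖Ut' - r • U' - U • r'‖) := by
  have hK0 : 0 < K := by linarith
  obtain ⟨N, hN⟩ : ∃ N, N = 200 * K^6 * (1/lam + K^2) := ⟨_, rfl⟩
  have hN0 : 0 < N := by rw [hN]; positivity
  refine ⟨N, hN0, N * (20*K^6) + 200*K^6, by positivity, ?_⟩
  intro B U Ut r k qt U' Ut' r' hs hB hc hkr hr0 hr hk hqt hqt' hU hUt hU' hUt' hr'
  have h1 := pw_R B hs U Ut r k qt U' Ut' r' hkr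
  have hY : |r * U| ≤ K^2 := by
    rw [abs_mul, abs_of_nonneg hr0]
    calc r * |U| ≤ K * K := by gcongr
      _ = _ := by ring
  have he : |Ut - r * U| ≤ 2*K^2 := by
    have := abs_sub Ut (r*U)
    nlinarith
  have hY' : ‖r • U' + U • r'‖ ≤ 2*K^2 := by
    have h2 := norm_add_le (r • U') (U • r')
    rw [norm_smul, norm_smul, Real.norm_eq_abs, Real.norm_eq_abs, abs_of_nonneg hr0] at h2
    have h3 : r * ‖U'‖ ≤ K * K := by gcongr
    have h4 : |U| * ‖r'‖ ≤ K * K := by gcongr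
    nlinarith
  have h2 := pw_Rbound B K hK hB (r*U) (Ut - r*U) k qt (r • U' + U • r') (Ut' - r • U' - U • r')
    Ut' r' hY he hk hqt hY' hUt' hr'
  have h3 := pw_W K hK U Ut r U' Ut' r' hU hUt hr0 hr hU' hUt' hr'
  set X := (B (Ut • (k^2 • r') + (1 - k) • Ut') Ut' - qt * Ut^2 * (1 - k))
        - (B (U • ((2*r-1) • r') + (r^2 - r) • U') U' - (r^2 * qt) * U^2 * (r^2 - r)) with hX
  set R := ((1-k) * (B (Ut' - r • U' - U • r') Ut' + B (r • U' + U • r') (Ut' - r • U' - U • r'))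
     + (Ut - r * U) * B (k^2 • r') Ut' + (r * U) * B (k^2 • r') (Ut' - r • U' - U • r')
     - qt * (1-k) * (2 * (r*U) * (Ut - r*U) + (Ut - r*U)^2)) with hR
  set d := |Ut - r * U| + ‖Ut' - r • U' - U • r'‖ with hd
  have hd0 : 0 ≤ d := by positivity
  have hR' := (abs_le.1 h2).1
  have hS : lam * (U^2 * ‖r'‖^2) ≤ U^2 * B r' r' := by
    have := mul_le_mul_of_nonneg_left (hc r') (sq_nonneg U)
    linarith
  have hT : U^2 * (r-1)^2 ≤ K^2 * (qt * r * U^2 * (r-1)^2 * (r+1)) := by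
    have hrK : 1 ≤ K * r := by
      rw [← hkr]
      exact mul_le_mul_of_nonneg_right ((le_abs_self k).trans hk) hr0
    have : 1 ≤ (K*qt)*(K*r)*(r+1) := by
      have := one_le_mul_of_one_le_of_one_le hqt' hrK
      exact one_le_mul_of_one_le_of_one_le this (by linarith)
    have h5 := mul_le_mul_of_nonneg_left this (show 0 ≤ U^2 * (r-1)^2 by positivity)
    linarith
  have hqt0 : 0 ≤ qt := by
    by_contra h
    have := mul_neg_of_pos_of_neg hK0 (not_le.1 h)
    linarith
  have hS0 : 0 ≤ U^2 * ‖r'‖^2 := by positivity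
  set S := U^2 * ‖r'‖^2
  set T := U^2 * (r-1)^2
  set Q := qt * r * U^2 * (r-1)^2 * (r+1)
  set P := U^2 * B r' r'
  have hQ0 : 0 ≤ Q := by positivity
  have hP0 : 0 ≤ P := le_trans (by positivity) hS
  have hPQ : P + Q ≤ X + 20*K^6*d := by linarith
  have hPQ0 : 0 ≤ X + 20*K^6*d := by linarith
  have hST : S + T ≤ (1/lam + K^2) * (P + Q) := by
    have : S ≤ 1/lam * P := by
      rw [one_div, ← div_eq_inv_mul, le_div_iff₀ hlam]; linarith
    have h6 : 0 ≤ 1/lam * Q := by positivity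
    have h7 : 0 ≤ K^2 * P := by positivity
    linarith
  have hd1 : S + T + d ≤ (1/lam + K^2) * (X + 20*K^6*d) + d := by
    have : (1/lam + K^2) * (P + Q) ≤ (1/lam + K^2) * (X + 20*K^6*d) := by gcongr
    linarith
  have h8 : 200 * K^6 * (S + T + d) ≤ N * (X + 20*K^6*d) + 200*K^6*d := by
    calc 200 * K^6 * (S + T + d) ≤ 200*K^6*((1/lam + K^2) * (X + 20*K^6*d) + d) := by gcongr
      _ = _ := by rw [hN]; ring
  have hfin : N * (X + 20*K^6*d) + 200*K^6*d = N * X + (N * (20*K^6) + 200*K^6) * d := by ring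
  linarith
theorem ibp_cpt {n : ℕ} {Ω K : Set (EuclideanSpace ℝ (Fin n))} (hΩo : IsOpen Ω)
    (hK : IsCompact K) (hKΩ : K ⊆ Ω) {f g : EuclideanSpace ℝ (Fin n) → ℝ} {L : NNReal}
    (hf : LipschitzWith L f) (hf0 : ∀ x ∉ K, f x = 0) (hg : ContDiffOn ℝ 1 g Ω)
    (v : EuclideanSpace ℝ (Fin n)) :
    IntegrableOn (fun x => fderiv ℝ f x v * g x + f x * fderiv ℝ g x v) Ω ∧
    ∫ x in Ω, (fderiv ℝ f x v * g x + f x * fderiv ℝ g x v) = 0 := by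
  obtain ⟨K', hK', hKK', hK'Ω⟩ := exists_compact_between hK hΩo hKΩ
  obtain ⟨ψ, hψ, -, hψs, hψ1⟩ := exists_contMDiff_support_eq_eq_one_iff (n := 1)
    (modelWithCornersSelf ℝ (EuclideanSpace ℝ (Fin n))) isOpen_interior hK.isClosed hKK'
  have hψc : ContDiff ℝ 1 ψ := hψ.contDiff
  have hts : tsupport ψ ⊆ K' := by
    rw [tsupport, hψs]
    exact closure_minimal interior_subset hK'.isClosed
  have hψK : HasCompactSupport ψ := HasCompactSupport.of_support_subset_isCompact hK'
    (subset_closure.trans hts)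
  set G : EuclideanSpace ℝ (Fin n) → ℝ := ψ * g with hG
  have hGc : HasCompactSupport G := hψK.mul_right
  have hGd : ContDiff ℝ 1 G := by
    rw [contDiff_iff_contDiffAt]
    intro x
    by_cases hx : x ∈ Ω
    · exact hψc.contDiffAt.mul (hg.contDiffAt (hΩo.mem_nhds hx))
    · have hx' : x ∉ tsupport ψ := fun h => hx (hK'Ω (hts h))
      have : G =ᶠ[nhds x] fun _ => 0 := by
        filter_upwards [notMem_tsupport_iff_eventuallyEq.1 hx'] with y hy
        simp [hG, hy]
      exact contDiffAt_const.congr_of_eventuallyEq this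
  obtain ⟨D, hGL⟩ := ContDiff.lipschitzWith_of_hasCompactSupport hGc hGd one_ne_zero
  have key := hf.integral_lineDeriv_mul_eq (μ := volume) hGL hGc v
  have hfd : ∀ᵐ x : EuclideanSpace ℝ (Fin n), DifferentiableAt ℝ f x := hf.ae_differentiableAt
  have e1 : ∫ x, lineDeriv ℝ f x v * G x = ∫ x, fderiv ℝ f x v * G x := by
    apply integral_congr_ae
    filter_upwards [hfd] with x hx
    rw [hx.lineDeriv_eq_fderiv]
  have e2 : ∫ x, lineDeriv ℝ G x (-v) * f x = - ∫ x, f x * fderiv ℝ G x v := by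
    rw [← integral_neg]
    congr 1
    ext x
    rw [(hGd.differentiable one_ne_zero x).lineDeriv_eq_fderiv, map_neg]
    ring
  have i1 : Integrable (fun x => fderiv ℝ f x v * G x) := by
    apply Integrable.bdd_mul (c := L * ‖v‖) (hGd.continuous.integrable_of_hasCompactSupport hGc)
    · exact (measurable_fderiv_apply_const ℝ f v).aestronglyMeasurable
    · refine Filter.Eventually.of_forall fun x => ?_
      refine (ContinuousLinearMap.le_opNorm _ _).trans ?_
      gcongr
      exact norm_fderiv_le_of_lipschitz ℝ hf
  have i2 : Integrable (fun x => f x * fderiv ℝ G x v) := by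
    apply Continuous.integrable_of_hasCompactSupport
    · exact hf.continuous.mul ((hGd.continuous_fderiv one_ne_zero).clm_apply continuous_const)
    · have : HasCompactSupport f := HasCompactSupport.intro hK hf0
      exact this.mul_right
  have h0 : ∫ x, (fderiv ℝ f x v * G x + f x * fderiv ℝ G x v) = 0 := by
    rw [integral_add i1 i2, ← e1, key, e2]; ring
  have hpt : (fun x => fderiv ℝ f x v * G x + f x * fderiv ℝ G x v) =
      (fun x => fderiv ℝ f x v * g x + f x * fderiv ℝ g x v) := by
    ext x
    have a1 : fderiv ℝ f x v * G x = fderiv ℝ f x v * g x := by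
      by_cases hx : x ∈ K
      · simp [hG, (hψ1 x).1 hx]
      · have : f =ᶠ[nhds x] fun _ => 0 := by
          filter_upwards [hK.isClosed.isOpen_compl.mem_nhds hx] with y hy using hf0 y hy
        rw [this.fderiv_eq]; simp
    have a2 : f x * fderiv ℝ G x v = f x * fderiv ℝ g x v := by
      by_cases hx : f x = 0
      · simp [hx]
      · have : G =ᶠ[nhds x] g := by
          filter_upwards [(isOpen_ne_fun hf.continuous continuous_const).mem_nhds hx] with y hy
          have : y ∈ K := by
            by_contra h
            exact hy (hf0 y h)
          simp [hG, (hψ1 y).1 this]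
        rw [this.fderiv_eq]
    rw [a1, a2]
  rw [hpt] at h0
  have hgint : Integrable (fun x => fderiv ℝ f x v * g x + f x * fderiv ℝ g x v) :=
    hpt ▸ i1.add i2
  refine ⟨hgint.integrableOn, ?_⟩
  rw [setIntegral_eq_integral_of_forall_compl_eq_zero, h0]
  intro x hx
  have hx' : x ∉ K := fun h => hx (hKΩ h)
  have : f =ᶠ[nhds x] fun _ => 0 := by
    filter_upwards [hK.isClosed.isOpen_compl.mem_nhds hx'] with y hy using hf0 y hy
  rw [this.fderiv_eq, hf0 x hx']; simp

/-- The weak-form integrand. -/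
def Hfun {n : ℕ} (A : Fin n → Fin n → EuclideanSpace ℝ (Fin n) → ℝ)
    (q u f : EuclideanSpace ℝ (Fin n) → ℝ) (x : EuclideanSpace ℝ (Fin n)) : ℝ :=
  (∑ i, ∑ j, A i j x * (u x * pd i f x + f x * pd i u x) * pd j u x) - q x * u x ^ 2 * f x

theorem wf_cpt {n : ℕ} {Ω K : Set (EuclideanSpace ℝ (Fin n))} (hΩo : IsOpen Ω)
    (hK : IsCompact K) (hKΩ : K ⊆ Ω) {f : EuclideanSpace ℝ (Fin n) → ℝ} {L : NNReal}
    (hf : LipschitzWith L f) (hf0 : ∀ x ∉ K, f x = 0)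
    (A : Fin n → Fin n → EuclideanSpace ℝ (Fin n) → ℝ) (q u : EuclideanSpace ℝ (Fin n) → ℝ)
    (hA : ∀ i j, ContDiffOn ℝ 1 (A i j) Ω) (hu : ContDiffOn ℝ 2 u Ω) (hsol : IsSolution A q u Ω) :
    ∫ x in Ω, Hfun A q u f x = 0 := by
  have hpd : ∀ j, ContDiffOn ℝ 1 (pd j u) Ω := by
    intro j
    have := hu.fderiv_of_isOpen hΩo (m := 1) (by norm_num)
    exact this.clm_apply contDiffOn_const
  have hAp : ∀ i j, ContDiffOn ℝ 1 (fun y => A i j y * pd j u y) Ω := fun i j => (hA i j).mul (hpd j)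
  have hu1 : ContDiffOn ℝ 1 u Ω := hu.of_le (by norm_num)
  have hg : ∀ i j, ContDiffOn ℝ 1 (fun y => u y * (A i j y * pd j u y)) Ω :=
    fun i j => hu1.mul (hAp i j)
  have hI := fun i j => ibp_cpt hΩo hK hKΩ hf hf0 (hg i j) (EuclideanSpace.single i 1)
  have : ∫ x in Ω, Hfun A q u f x = ∫ x in Ω, ∑ i, ∑ j,
      (fderiv ℝ f x (EuclideanSpace.single i 1) * (u x * (A i j x * pd j u x)) +
      f x * fderiv ℝ (fun y => u y * (A i j y * pd j u y)) x (EuclideanSpace.single i 1)) := by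
    apply setIntegral_congr_fun hΩo.measurableSet
    intro x hx
    have hnx := hΩo.mem_nhds hx
    have hud : DifferentiableAt ℝ u x := (hu1.contDiffAt hnx).differentiableAt one_ne_zero
    have hd : ∀ i j, fderiv ℝ (fun y => u y * (A i j y * pd j u y)) x (EuclideanSpace.single i 1) =
        u x * pd i (fun y => A i j y * pd j u y) x + A i j x * pd j u x * pd i u x := by
      intro i j
      rw [fderiv_fun_mul hud (((hAp i j).contDiffAt hnx).differentiableAt one_ne_zero)]
      simp [pd]
    have hs := hsol x hx
    simp only [hd, Hfun]
    have hs' : q x * u x ^ 2 * f x = - ∑ i, ∑ j, f x * u x * pd i (fun y => A i j y * pd j u y) x := by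
      simp only [← Finset.mul_sum]
      linear_combination (f x * u x) * hs
    rw [hs', sub_neg_eq_add, ← Finset.sum_add_distrib]
    refine Finset.sum_congr rfl fun i _ => ?_
    rw [← Finset.sum_add_distrib]
    refine Finset.sum_congr rfl fun j _ => ?_
    simp only [pd]
    ring
  rw [this, integral_finsetSum]
  · refine Finset.sum_eq_zero fun i _ => ?_
    rw [integral_finsetSum]
    · exact Finset.sum_eq_zero fun j _ => (hI i j).2
    · exact fun j _ => (hI i j).1
  · exact fun i _ => integrable_finsetSum _ fun j _ => (hI i j).1

theorem pd_abs_le {n : ℕ} (i : Fin n) (f : EuclideanSpace ℝ (Fin n) → ℝ)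
    (x : EuclideanSpace ℝ (Fin n)) : |pd i f x| ≤ ‖fderiv ℝ f x‖ := by
  have := (fderiv ℝ f x).le_opNorm (EuclideanSpace.single i 1)
  simpa [pd] using this

theorem Hfun_bound {n : ℕ} (A : Fin n → Fin n → EuclideanSpace ℝ (Fin n) → ℝ)
    (q u f : EuclideanSpace ℝ (Fin n) → ℝ) (x : EuclideanSpace ℝ (Fin n)) (KA M N L : ℝ)
    (hKA : ∀ i j, |A i j x| ≤ KA) (hq : |q x| ≤ M) (hu : |u x| ≤ M) (hu' : ‖fderiv ℝ u x‖ ≤ M)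
    (hf : |f x| ≤ N) (hf' : ‖fderiv ℝ f x‖ ≤ L) (hM : 0 ≤ M) (hN : 0 ≤ N) (hL : 0 ≤ L)
    (hKA0 : 0 ≤ KA) :
    ‖Hfun A q u f x‖ ≤ (∑ _i : Fin n, ∑ _j : Fin n, KA * (M * L + N * M) * M) + M * M^2 * N := by
  unfold Hfun
  refine (norm_sub_le _ _).trans (add_le_add ?_ ?_)
  · refine (norm_sum_le _ _).trans (Finset.sum_le_sum fun i _ => ?_)
    refine (norm_sum_le _ _).trans (Finset.sum_le_sum fun j _ => ?_)
    rw [norm_mul, norm_mul]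
    simp only [Real.norm_eq_abs]
    have h1 : |u x * pd i f x + f x * pd i u x| ≤ M * L + N * M := by
      refine (abs_add_le _ _).trans ?_
      rw [abs_mul, abs_mul]
      have := (pd_abs_le i f x).trans hf'
      have := (pd_abs_le i u x).trans hu'
      gcongr
    have := (pd_abs_le j u x).trans hu'
    have := hKA i j
    gcongr
  · rw [norm_mul, norm_mul, norm_pow]
    simp only [Real.norm_eq_abs]
    gcongr

theorem Hfun_meas {n : ℕ} {Ω : Set (EuclideanSpace ℝ (Fin n))} (hΩo : IsOpen Ω)
    (A : Fin n → Fin n → EuclideanSpace ℝ (Fin n) → ℝ)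
    (q u f : EuclideanSpace ℝ (Fin n) → ℝ) (hA : ∀ i j, ContinuousOn (A i j) Ω)
    (hq : ContinuousOn q Ω) (hu : ContinuousOn u Ω) (hf : ContinuousOn f Ω) :
    AEStronglyMeasurable (Hfun A q u f) (volume.restrict Ω) := by
  have hm : ∀ {g : EuclideanSpace ℝ (Fin n) → ℝ}, ContinuousOn g Ω →
      AEMeasurable g (volume.restrict Ω) :=
    fun hg => hg.aemeasurable hΩo.measurableSet
  have hp : ∀ (i : Fin n) (g : EuclideanSpace ℝ (Fin n) → ℝ),
      AEMeasurable (pd i g) (volume.restrict Ω) := fun i g =>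
    (measurable_fderiv_apply_const ℝ g _).aemeasurable
  apply AEMeasurable.aestronglyMeasurable
  unfold Hfun
  refine AEMeasurable.sub ?_ (((hm hq).mul ((hm hu).pow_const 2)).mul (hm hf))
  refine Finset.aemeasurable_fun_sum _ fun i _ => ?_
  refine Finset.aemeasurable_fun_sum _ fun j _ => ?_
  exact ((hm (hA i j)).mul (((hm hu).mul (hp i f)).add ((hm hf).mul (hp i u)))).mul (hp j u)
theorem wf_main {n : ℕ} {Ω : Set (EuclideanSpace ℝ (Fin n))} (hΩo : IsOpen Ω)
    (hΩb : Bornology.IsBounded Ω) (hΩn : Ωᶜ.Nonempty)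
    {f : EuclideanSpace ℝ (Fin n) → ℝ} {L : NNReal} {c N : ℝ}
    (hf : LipschitzWith L f) (hc : 0 ≤ c) (hfd : ∀ x ∈ Ω, |f x| ≤ c * infDist x Ωᶜ)
    (hfN : ∀ x ∈ Ω, |f x| ≤ N) (hN : 0 ≤ N)
    (A : Fin n → Fin n → EuclideanSpace ℝ (Fin n) → ℝ) (q u : EuclideanSpace ℝ (Fin n) → ℝ)
    (KA M : ℝ) (hKA0 : 0 ≤ KA) (hM : 0 ≤ M)
    (hA : ∀ i j, ContDiffOn ℝ 1 (A i j) Ω) (hKA : ∀ x ∈ Ω, ∀ i j, |A i j x| ≤ KA)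
    (hu : ContDiffOn ℝ 2 u Ω) (huM : ∀ x ∈ Ω, |u x| ≤ M) (huM' : ∀ x ∈ Ω, ‖fderiv ℝ u x‖ ≤ M)
    (hq : ContinuousOn q Ω) (hqM : ∀ x ∈ Ω, |q x| ≤ M)
    (hsol : IsSolution A q u Ω) :
    IntegrableOn (Hfun A q u f) Ω ∧ ∫ x in Ω, Hfun A q u f x = 0 := by
  have hvol : volume Ω ≠ ⊤ := hΩb.measure_lt_top.ne
  have : IsFiniteMeasure (volume.restrict Ω) := ⟨by simpa using hΩb.measure_lt_top⟩
  have hAc : ∀ i j, ContinuousOn (A i j) Ω := fun i j => (hA i j).continuousOn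
  constructor
  · refine Integrable.of_bound (Hfun_meas hΩo A q u f hAc hq hu.continuousOn hf.continuous.continuousOn)
      ((∑ _i : Fin n, ∑ _j : Fin n, KA * (M * L + N * M) * M) + M * M^2 * N) ?_
    refine (ae_restrict_iff' hΩo.measurableSet).2 (Filter.Eventually.of_forall fun x hx => ?_)
    exact Hfun_bound A q u f x KA M N L (hKA x hx) (hqM x hx) (huM x hx) (huM' x hx) (hfN x hx)
      (norm_fderiv_le_of_lipschitz ℝ hf) hM hN L.2 hKA0
  set d : EuclideanSpace ℝ (Fin n) → ℝ := fun x => infDist x Ωᶜ with hd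
  have hdL : LipschitzWith 1 d := lipschitz_infDist_pt _
  set ε : ℕ → ℝ := fun k => 1 / ((k : ℝ) + 1) with hε
  have hε0 : ∀ k, 0 < ε k := fun k => by simp only [hε]; positivity
  set g : ℕ → EuclideanSpace ℝ (Fin n) → ℝ := fun k x => 2 * c * max (d x - ε k) 0 with hg
  have hg0 : ∀ k x, 0 ≤ g k x := fun k x => by simp only [hg]; positivity
  set F : ℕ → EuclideanSpace ℝ (Fin n) → ℝ := fun k x => max (-(g k x)) (min (f x) (g k x)) with hF
  obtain ⟨L', hFL⟩ : ∃ L' : NNReal, ∀ k, LipschitzWith L' (F k) := by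
    have hgL : ∀ k, LipschitzWith (Real.toNNReal (2*c)) (g k) := by
      intro k
      have h1 : LipschitzWith 1 (fun x => max (d x - ε k) 0) := by
        have : LipschitzWith 1 (fun x => d x - ε k) := by
          apply LipschitzWith.of_dist_le_mul
          intro x y
          have := hdL.dist_le_mul x y
          simpa [Real.dist_eq] using this
        exact this.max_const 0
      apply LipschitzWith.of_dist_le_mul
      intro x y
      have := h1.dist_le_mul x y
      rw [Real.dist_eq] at this ⊢
      simp only [hg]
      rw [← mul_sub, abs_mul, abs_of_nonneg (by positivity : 0 ≤ 2*c),
        Real.coe_toNNReal _ (by positivity)]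
      gcongr
      simpa using this
    exact ⟨_, fun k => (hgL k).neg.max (hf.min (hgL k))⟩
  have hFabs : ∀ k x, |F k x| ≤ |f x| := by
    intro k x
    have h0 := hg0 k x
    simp only [hF]
    rw [abs_le]
    constructor
    · refine le_max_of_le_right (le_min (neg_abs_le _) (by linarith [abs_nonneg (f x)]))
    · exact max_le (by linarith [abs_nonneg (f x)]) ((min_le_left _ _).trans (le_abs_self _))
  have hFeq : ∀ k, ∀ x ∈ Ω, 2 * ε k ≤ d x → F k x = f x := by
    intro k x hx hdx
    have h1 := hfd x hx
    have h2 : c * d x ≤ g k x := by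
      simp only [hg]
      have : d x ≤ 2 * max (d x - ε k) 0 := by
        have := le_max_left (d x - ε k) 0
        linarith
      nlinarith
    have h3 := abs_le.1 (h1.trans h2)
    simp only [hF]
    rw [min_eq_left h3.2, max_eq_right h3.1]
  have hFz : ∀ k, ∫ x in Ω, Hfun A q u (F k) x = 0 := by
    intro k
    set K := {x | ε k ≤ d x} with hKdef
    have hKΩ : K ⊆ Ω := by
      intro x hx
      by_contra h
      have : d x = 0 := infDist_zero_of_mem h
      have h2 : ε k ≤ d x := hx
      linarith [hε0 k]
    have hKc : IsCompact K := by
      apply Metric.isCompact_of_isClosed_isBounded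
      · exact isClosed_le continuous_const hdL.continuous
      · exact hΩb.subset hKΩ
    refine wf_cpt hΩo hKc hKΩ (hFL k) ?_ A q u hA hu hsol
    intro x hx
    have : d x < ε k := not_le.1 hx
    have hgz : g k x = 0 := by
      simp only [hg]; rw [max_eq_right (by linarith)]; simp
    simp only [hF, hgz]
    simp
  have hlim : Filter.Tendsto (fun k => ∫ x in Ω, Hfun A q u (F k) x) Filter.atTop
      (nhds (∫ x in Ω, Hfun A q u f x)) := by
    apply tendsto_integral_of_dominated_convergence
      (fun _ => (∑ _i : Fin n, ∑ _j : Fin n, KA * (M * L' + N * M) * M) + M * M^2 * N)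
    · intro k
      exact Hfun_meas hΩo A q u _ hAc hq hu.continuousOn (hFL k).continuous.continuousOn
    · exact integrable_const _
    · intro k
      refine (ae_restrict_iff' hΩo.measurableSet).2 (Filter.Eventually.of_forall fun x hx => ?_)
      exact Hfun_bound A q u _ x KA M N L' (hKA x hx) (hqM x hx) (huM x hx) (huM' x hx)
        ((hFabs k x).trans (hfN x hx)) (norm_fderiv_le_of_lipschitz ℝ (hFL k)) hM hN L'.2 hKA0
    · refine (ae_restrict_iff' hΩo.measurableSet).2 (Filter.Eventually.of_forall fun x hx => ?_)
      apply tendsto_const_nhds.congr'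
      have hdx : 0 < d x :=
        (hΩo.isClosed_compl.notMem_iff_infDist_pos hΩn).1 (fun h => h hx)
      have : Filter.Tendsto (fun k => 2 * ε k) Filter.atTop (nhds (2 * 0)) :=
        tendsto_one_div_add_atTop_nhds_zero_nat.const_mul 2
      rw [mul_zero] at this
      filter_upwards [this.eventually (gt_mem_nhds hdx)] with k hk
      have hev : F k =ᶠ[nhds x] f := by
        filter_upwards [hΩo.mem_nhds hx, hdL.continuous.continuousAt.eventually (lt_mem_nhds hk)]
          with y hy hy2 using hFeq k y hy hy2.le
      simp only [Hfun, pd, hev.fderiv_eq, hev.eq_of_nhds]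
  simp only [hFz] at hlim
  exact (tendsto_nhds_unique hlim tendsto_const_nhds)
theorem wf_on {n : ℕ} {Ω : Set (EuclideanSpace ℝ (Fin n))} (hΩo : IsOpen Ω)
    (hΩb : Bornology.IsBounded Ω) (hΩn : Ωᶜ.Nonempty)
    {f : EuclideanSpace ℝ (Fin n) → ℝ} {L : NNReal}
    (hf : LipschitzOnWith L f (closure Ω)) (hf0 : ∀ x ∈ frontier Ω, f x = 0)
    (A : Fin n → Fin n → EuclideanSpace ℝ (Fin n) → ℝ) (q u : EuclideanSpace ℝ (Fin n) → ℝ)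
    (KA M : ℝ) (hKA0 : 0 ≤ KA) (hM : 0 ≤ M)
    (hA : ∀ i j, ContDiffOn ℝ 1 (A i j) Ω) (hKA : ∀ x ∈ Ω, ∀ i j, |A i j x| ≤ KA)
    (hu : ContDiffOn ℝ 2 u Ω) (huM : ∀ x ∈ Ω, |u x| ≤ M) (huM' : ∀ x ∈ Ω, ‖fderiv ℝ u x‖ ≤ M)
    (hq : ContinuousOn q Ω) (hqM : ∀ x ∈ Ω, |q x| ≤ M)
    (hsol : IsSolution A q u Ω) :
    IntegrableOn (Hfun A q u f) Ω ∧ ∫ x in Ω, Hfun A q u f x = 0 := by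
  obtain ⟨f₁, hf₁, heq⟩ := hf.extend_real
  have hcpt : IsCompact (closure Ω) := hΩb.isCompact_closure
  obtain ⟨N, hN⟩ := hcpt.exists_bound_of_continuousOn hf.continuousOn
  have hdist : ∀ x ∈ Ω, |f₁ x| ≤ L * infDist x Ωᶜ := by
    intro x hx
    obtain ⟨y, hy, hxy⟩ := exists_mem_frontier_infDist_compl_eq_dist hx
      (fun h => by rw [h] at hΩn; simp at hΩn)
    have h1 := hf₁.dist_le_mul x y
    have h2 : f₁ y = 0 := by rw [← heq (frontier_subset_closure hy), hf0 y hy]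
    rw [hxy]
    simpa [Real.dist_eq, h2] using h1
  have hbd : ∀ x ∈ Ω, |f₁ x| ≤ max N 0 := by
    intro x hx
    rw [← heq (subset_closure hx)]
    exact (hN x (subset_closure hx)).trans (le_max_left _ _)
  have h := wf_main hΩo hΩb hΩn hf₁ L.2 hdist hbd (le_max_right _ _) A q u KA M hKA0 hM hA hKA hu
    huM huM' hq hqM hsol
  have hE : EqOn (Hfun A q u f₁) (Hfun A q u f) Ω := by
    intro x hx
    have hev : f₁ =ᶠ[nhds x] f := by
      filter_upwards [hΩo.mem_nhds hx] with y hy using (heq (subset_closure hy)).symm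
    simp only [Hfun, pd, hev.fderiv_eq, hev.eq_of_nhds]
  refine ⟨h.1.congr_fun hE hΩo.measurableSet, ?_⟩
  rw [← setIntegral_congr_fun hΩo.measurableSet hE, h.2]

/-- Bounded Lipschitz functions on a set. -/
def LB {n : ℕ} (s : Set (EuclideanSpace ℝ (Fin n))) (f : EuclideanSpace ℝ (Fin n) → ℝ) : Prop :=
  (∃ L : ℝ, 0 ≤ L ∧ ∀ x ∈ s, ∀ y ∈ s, |f x - f y| ≤ L * dist x y) ∧
  ∃ C : ℝ, 0 ≤ C ∧ ∀ x ∈ s, |f x| ≤ C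

theorem LB.mul {n : ℕ} {s : Set (EuclideanSpace ℝ (Fin n))} {f g : EuclideanSpace ℝ (Fin n) → ℝ}
    (hf : LB s f) (hg : LB s g) : LB s (fun x => f x * g x) := by
  obtain ⟨⟨L, hL, h1⟩, C, hC, h2⟩ := hf
  obtain ⟨⟨L', hL', h1'⟩, C', hC', h2'⟩ := hg
  refine ⟨⟨C * L' + L * C', by positivity, fun x hx y hy => ?_⟩, C * C', by positivity, fun x hx => ?_⟩
  · have : f x * g x - f y * g y = f x * (g x - g y) + (f x - f y) * g y := by ring
    rw [this]
    refine (abs_add_le _ _).trans ?_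
    rw [abs_mul, abs_mul]
    have a1 := h1 x hx y hy
    have a2 := h1' x hx y hy
    have a3 := h2 x hx
    have a4 := h2' y hy
    calc |f x| * |g x - g y| + |f x - f y| * |g y| ≤ C * (L' * dist x y) + (L * dist x y) * C' := by
          gcongr
      _ = _ := by ring
  · rw [abs_mul]
    have a3 := h2 x hx
    have a4 := h2' x hx
    gcongr

theorem LB.sub {n : ℕ} {s : Set (EuclideanSpace ℝ (Fin n))} {f g : EuclideanSpace ℝ (Fin n) → ℝ}
    (hf : LB s f) (hg : LB s g) : LB s (fun x => f x - g x) := by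
  obtain ⟨⟨L, hL, h1⟩, C, hC, h2⟩ := hf
  obtain ⟨⟨L', hL', h1'⟩, C', hC', h2'⟩ := hg
  refine ⟨⟨L + L', by positivity, fun x hx y hy => ?_⟩, C + C', by positivity, fun x hx => ?_⟩
  · have : f x - g x - (f y - g y) = (f x - f y) - (g x - g y) := by ring
    rw [this]
    refine (abs_sub _ _).trans ?_
    have a1 := h1 x hx y hy
    have a2 := h1' x hx y hy
    linarith
  · refine (abs_sub _ _).trans ?_
    have a3 := h2 x hx
    have a4 := h2' x hx
    linarith

theorem LB.const {n : ℕ} {s : Set (EuclideanSpace ℝ (Fin n))} (c : ℝ) : LB s (fun _ => c) :=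
  ⟨⟨0, le_rfl, by simp⟩, |c|, abs_nonneg _, fun _ _ => le_rfl⟩

theorem LB.sqrt {n : ℕ} {s : Set (EuclideanSpace ℝ (Fin n))} {f : EuclideanSpace ℝ (Fin n) → ℝ}
    {c : ℝ} (hc : 0 < c) (hf : LB s f) (hfc : ∀ x ∈ s, c ≤ f x) : LB s (fun x => √(f x)) := by
  obtain ⟨⟨L, hL, h1⟩, C, hC, h2⟩ := hf
  refine ⟨⟨L / √c, by positivity, fun x hx y hy => ?_⟩, √C, by positivity, fun x hx => ?_⟩
  · have hx1 := hfc x hx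
    have hy1 := hfc y hy
    have hsc : 0 < √c := Real.sqrt_pos.2 hc
    have hsx : √c ≤ √(f x) := Real.sqrt_le_sqrt hx1
    have e : (√(f x) - √(f y)) * (√(f x) + √(f y)) = f x - f y := by
      have a1 := Real.mul_self_sqrt (hc.le.trans hx1)
      have a2 := Real.mul_self_sqrt (hc.le.trans hy1)
      linear_combination a1 - a2
    rw [div_mul_eq_mul_div, le_div_iff₀ hsc]
    refine le_trans ?_ (h1 x hx y hy)
    rw [← e, abs_mul]
    gcongr
    rw [abs_of_nonneg (by positivity)]
    linarith [Real.sqrt_nonneg (f y)]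
  · rw [abs_of_nonneg (Real.sqrt_nonneg _)]
    exact Real.sqrt_le_sqrt ((le_abs_self _).trans (h2 x hx))

theorem LB.inv {n : ℕ} {s : Set (EuclideanSpace ℝ (Fin n))} {f : EuclideanSpace ℝ (Fin n) → ℝ}
    {c : ℝ} (hc : 0 < c) (hf : LB s f) (hfc : ∀ x ∈ s, c ≤ f x) : LB s (fun x => (f x)⁻¹) := by
  obtain ⟨⟨L, hL, h1⟩, C, hC, h2⟩ := hf
  refine ⟨⟨L / (c * c), by positivity, fun x hx y hy => ?_⟩, c⁻¹, by positivity, fun x hx => ?_⟩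
  · have hx1 := hfc x hx
    have hy1 := hfc y hy
    have hx0 := hc.trans_le hx1
    have hy0 := hc.trans_le hy1
    have e : (f x)⁻¹ - (f y)⁻¹ = (f y - f x) / (f x * f y) := by field_simp
    rw [e, abs_div, abs_of_pos (by positivity : 0 < f x * f y), div_mul_eq_mul_div, abs_sub_comm]
    have := h1 x hx y hy
    gcongr
  · have hx1 := hfc x hx
    have hx0 := hc.trans_le hx1
    rw [abs_of_pos (by positivity)]
    exact inv_anti₀ hc hx1

theorem LB.lip {n : ℕ} {s : Set (EuclideanSpace ℝ (Fin n))} {f : EuclideanSpace ℝ (Fin n) → ℝ}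
    (hf : LB s f) : ∃ L : NNReal, LipschitzOnWith L f s := by
  obtain ⟨⟨L, hL, h1⟩, -⟩ := hf
  refine ⟨⟨L, hL⟩, LipschitzOnWith.of_dist_le_mul fun x hx y hy => ?_⟩
  rw [Real.dist_eq]
  exact h1 x hx y hy

theorem LB.of_W1 {n : ℕ} {Ω : Set (EuclideanSpace ℝ (Fin n))} {f : EuclideanSpace ℝ (Fin n) → ℝ}
    {M : ℝ} (hM : 0 ≤ M) (hf : W1InfBound Ω f M) : LB (closure Ω) f := by
  obtain ⟨K, h1, h2⟩ := hf
  refine ⟨⟨K, K.2, fun x hx y hy => ?_⟩, M, hM, fun x hx => ?_⟩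
  · simpa [Real.dist_eq] using h1.dist_le_mul x hx y hy
  · have := h2 x hx
    have := K.2
    linarith

theorem ae_diff_of_lipOn {n : ℕ} {Ω : Set (EuclideanSpace ℝ (Fin n))} (hΩo : IsOpen Ω)
    {f : EuclideanSpace ℝ (Fin n) → ℝ} {L : NNReal} (hf : LipschitzOnWith L f Ω) :
    ∀ᵐ x ∂(volume.restrict Ω), DifferentiableAt ℝ f x := by
  rw [ae_restrict_iff' hΩo.measurableSet]
  filter_upwards [hf.ae_differentiableWithinAt_of_mem (μ := volume)] with x hx hxΩ
  exact (hx hxΩ).differentiableAt (hΩo.mem_nhds hxΩ)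

theorem ae_diff_abs {n : ℕ} {Ω : Set (EuclideanSpace ℝ (Fin n))} (hΩo : IsOpen Ω)
    {u : EuclideanSpace ℝ (Fin n) → ℝ} (hu : ContDiffOn ℝ 1 u Ω) :
    ∀ᵐ x ∂(volume.restrict Ω), DifferentiableAt ℝ (fun y => |u y|) x := by
  rw [ae_restrict_iff' hΩo.measurableSet, ae_iff]
  apply measure_null_of_locally_null
  intro x hx
  simp only [Classical.not_imp, mem_ofPred_eq] at hx
  obtain ⟨K, t, ht, hL⟩ := (hu.contDiffAt (hΩo.mem_nhds hx.1)).exists_lipschitzOnWith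
  have hL' : LipschitzOnWith K (fun y => |u y|) (interior t) := by
    apply LipschitzOnWith.of_dist_le_mul
    intro a ha b hb
    refine le_trans ?_ (hL.dist_le_mul a (interior_subset ha) b (interior_subset hb))
    rw [Real.dist_eq, Real.dist_eq]
    exact abs_abs_sub_abs_le _ _
  have := ae_diff_of_lipOn isOpen_interior hL'
  rw [ae_restrict_iff' isOpen_interior.measurableSet, ae_iff] at this
  refine ⟨{y | ¬(y ∈ Ω → DifferentiableAt ℝ (fun y => |u y|) y)} ∩ interior t, ?_, ?_⟩
  · exact Filter.inter_mem self_mem_nhdsWithin (mem_nhdsWithin_of_mem_nhds (interior_mem_nhds.2 ht))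
  · refine measure_mono_null ?_ this
    rintro y ⟨hy1, hy2⟩
    simp only [Classical.not_imp, mem_ofPred_eq] at hy1 ⊢
    exact ⟨hy2, hy1.2⟩

theorem abs_deriv_sign {E : Type*} [NormedAddCommGroup E] [NormedSpace ℝ E] {u : E → ℝ} {x : E}
    (hu : DifferentiableAt ℝ u x) (ha : DifferentiableAt ℝ (fun y => |u y|) x) :
    ∃ s : ℝ, s * s = 1 ∧ |u x| = s * u x ∧ fderiv ℝ (fun y => |u y|) x = s • fderiv ℝ u x := by
  rcases lt_trichotomy (u x) 0 with h | h | h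
  · refine ⟨-1, by norm_num, by rw [abs_of_neg h]; ring, ?_⟩
    have : (fun y => |u y|) =ᶠ[nhds x] fun y => -(u y) := by
      filter_upwards [hu.continuousAt.eventually (gt_mem_nhds h)] with y hy using abs_of_neg hy
    rw [this.fderiv_eq, fderiv_fun_neg]; simp
  · refine ⟨1, by norm_num, by rw [h]; simp, ?_⟩
    have hmin : IsLocalMin (fun y => |u y|) x := by
      refine Filter.Eventually.of_forall fun y => ?_
      simp [h]
    have h0 := hmin.fderiv_eq_zero
    have h1 := ha.hasFDerivAt
    rw [h0] at h1
    have h2 : HasFDerivAt u (0 : E →L[ℝ] ℝ) x := by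
      rw [hasFDerivAt_iff_isLittleO] at h1 ⊢
      simp only [h, abs_zero, sub_zero, zero_apply] at h1 ⊢
      exact Asymptotics.IsLittleO.of_norm_left h1
    rw [h0, h2.fderiv]; simp
  · refine ⟨1, by norm_num, by rw [abs_of_pos h]; ring, ?_⟩
    have : (fun y => |u y|) =ᶠ[nhds x] fun y => (u y) := by
      filter_upwards [hu.continuousAt.eventually (lt_mem_nhds h)] with y hy using abs_of_pos hy
    rw [this.fderiv_eq]; simp

/-- The bilinear form of `A x` on the dual space. -/
def Bform {n : ℕ} (A : Fin n → Fin n → EuclideanSpace ℝ (Fin n) → ℝ)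
    (x : EuclideanSpace ℝ (Fin n)) :
    (EuclideanSpace ℝ (Fin n) →L[ℝ] ℝ) →ₗ[ℝ] (EuclideanSpace ℝ (Fin n) →L[ℝ] ℝ) →ₗ[ℝ] ℝ :=
  LinearMap.mk₂ ℝ (fun l m => ∑ i, ∑ j, A i j x * l (EuclideanSpace.single i 1) *
      m (EuclideanSpace.single j 1))
    (by intro a b c; simp only [← Finset.sum_add_distrib]; congr! 2; simp; ring)
    (by intro t a c; simp only [smul_eq_mul, Finset.mul_sum]; congr! 2; simp; ring)
    (by intro a b c; simp only [← Finset.sum_add_distrib]; congr! 2; simp; ring)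
    (by intro t a c; simp only [smul_eq_mul, Finset.mul_sum]; congr! 2; simp; ring)

theorem Bform_apply {n : ℕ} (A : Fin n → Fin n → EuclideanSpace ℝ (Fin n) → ℝ)
    (x : EuclideanSpace ℝ (Fin n)) (l m : EuclideanSpace ℝ (Fin n) →L[ℝ] ℝ) :
    Bform A x l m = ∑ i, ∑ j, A i j x * l (EuclideanSpace.single i 1) *
      m (EuclideanSpace.single j 1) := rfl

theorem Hfun_eq {n : ℕ} (A : Fin n → Fin n → EuclideanSpace ℝ (Fin n) → ℝ)
    (q u f : EuclideanSpace ℝ (Fin n) → ℝ) (x : EuclideanSpace ℝ (Fin n)) :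
    Hfun A q u f x = Bform A x (u x • fderiv ℝ f x + f x • fderiv ℝ u x) (fderiv ℝ u x)
      - q x * u x ^ 2 * f x := by
  rw [Hfun, Bform_apply]; simp [pd]

theorem Bform_symm {n : ℕ} (A : Fin n → Fin n → EuclideanSpace ℝ (Fin n) → ℝ)
    (x : EuclideanSpace ℝ (Fin n)) (hs : ∀ i j, A i j x = A j i x)
    (l m : EuclideanSpace ℝ (Fin n) →L[ℝ] ℝ) : Bform A x l m = Bform A x m l := by
  rw [Bform_apply, Bform_apply, Finset.sum_comm]
  refine Finset.sum_congr rfl fun i _ => Finset.sum_congr rfl fun j _ => ?_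
  rw [hs]; ring

theorem Bform_bound {n : ℕ} (A : Fin n → Fin n → EuclideanSpace ℝ (Fin n) → ℝ)
    (x : EuclideanSpace ℝ (Fin n)) (KA : ℝ) (hKA : ∀ i j, |A i j x| ≤ KA) (hKA0 : 0 ≤ KA)
    (l m : EuclideanSpace ℝ (Fin n) →L[ℝ] ℝ) :
    |Bform A x l m| ≤ (n * n * KA) * ‖l‖ * ‖m‖ := by
  rw [Bform_apply]
  have h : ∀ (l : EuclideanSpace ℝ (Fin n) →L[ℝ] ℝ) i, |l (EuclideanSpace.single i 1)| ≤ ‖l‖ := by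
    intro l i
    simpa using l.le_opNorm (EuclideanSpace.single i 1)
  calc |∑ i, ∑ j, A i j x * l (EuclideanSpace.single i 1) * m (EuclideanSpace.single j 1)|
      ≤ ∑ _i : Fin n, ∑ _j : Fin n, KA * ‖l‖ * ‖m‖ := by
        refine (Finset.abs_sum_le_sum_abs _ _).trans (Finset.sum_le_sum fun i _ => ?_)
        refine (Finset.abs_sum_le_sum_abs _ _).trans (Finset.sum_le_sum fun j _ => ?_)
        rw [abs_mul, abs_mul]
        have := h l i
        have := h m j
        have := hKA i j
        gcongr
    _ = _ := by simp; ring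

theorem Bform_coercive {n : ℕ} (A : Fin n → Fin n → EuclideanSpace ℝ (Fin n) → ℝ)
    (x : EuclideanSpace ℝ (Fin n)) (lam : ℝ) (hlam : 0 < lam)
    (hc : ∀ ξ : EuclideanSpace ℝ (Fin n), lam * ‖ξ‖ ^ 2 ≤ ∑ i, ∑ j, A i j x * ξ i * ξ j)
    (l : EuclideanSpace ℝ (Fin n) →L[ℝ] ℝ) : lam * ‖l‖ ^ 2 ≤ Bform A x l l := by
  set ξ := (InnerProductSpace.toDual ℝ (EuclideanSpace ℝ (Fin n))).symm l with hξ
  have hn : ‖ξ‖ = ‖l‖ := by simp [hξ]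
  have hi : ∀ i, l (EuclideanSpace.single i 1) = ξ i := by
    intro i
    rw [← InnerProductSpace.toDual_symm_apply (𝕜 := ℝ) (y := l)]
    rw [← hξ, EuclideanSpace.inner_single_right]
    simp
  rw [Bform_apply, ← hn]
  simp only [hi]
  exact hc ξ

theorem d_ratio {E : Type*} [NormedAddCommGroup E] [NormedSpace ℝ E] {a b : E → ℝ} {x : E}
    {a' b' : E →L[ℝ] ℝ} (ha : HasFDerivAt a a' x) (hb : HasFDerivAt b b' x) (hb0 : 0 < b x) :
    HasFDerivAt (fun y => a y * (b y)⁻¹) ((b x)⁻¹ • (a' - (a x * (b x)⁻¹) • b')) x := by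
  have h1 := ha.mul ((hasDerivAt_inv hb0.ne').comp_hasFDerivAt x hb)
  refine h1.congr_fderiv ?_
  ext v
  simp [Function.comp]
  field_simp
  ring

theorem d_ratio2 {E : Type*} [NormedAddCommGroup E] [NormedSpace ℝ E] {a b : E → ℝ} {x : E}
    {a' b' : E →L[ℝ] ℝ} (ha : HasFDerivAt a a' x) (hb : HasFDerivAt b b' x) (hb0 : 0 < b x)
    (ha0 : 0 < a x) :
    HasFDerivAt (fun y => 1 - b y * (a y)⁻¹)
      ((b x * (a x)⁻¹) ^ 2 • ((b x)⁻¹ • (a' - (a x * (b x)⁻¹) • b'))) x := by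
  have h1 := (d_ratio hb ha ha0).const_sub 1
  refine h1.congr_fderiv ?_
  ext v
  simp
  field_simp
  ring

theorem d_sq {E : Type*} [NormedAddCommGroup E] [NormedSpace ℝ E] {r : E → ℝ} {x : E}
    {r' : E →L[ℝ] ℝ} (hr : HasFDerivAt r r' x) :
    HasFDerivAt (fun y => r y * r y - r y) ((2 * r x - 1) • r') x := by
  have h1 := (hr.mul hr).sub hr
  refine h1.congr_fderiv ?_
  ext v
  simp
  ring

theorem De_alg {V : Type*} [AddCommGroup V] [Module ℝ V] (a b U Ut : ℝ) (hb : b ≠ 0)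
    (a' b' U' Ut' : V) :
    Ut' - (a * b⁻¹) • U' - U • (b⁻¹ • (a' - (a * b⁻¹) • b')) =
      -(b⁻¹ • ((a • U' + U • a') - (b • Ut' + Ut • b'))) - (b⁻¹ * (Ut - (a * b⁻¹) * U)) • b' := by
  match_scalars <;> field_simp <;> ring

theorem sqrt_bd {E : Type*} [NormedAddCommGroup E] [NormedSpace ℝ E] {q : E → ℝ} {x : E}
    {q₀ M : ℝ} (hq₀ : 0 < q₀) (hM : 0 < M) (h1 : q₀ ≤ q x) (h2 : q x ≤ M)
    (hd : DifferentiableAt ℝ q x)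
    (hb : ‖fderiv ℝ q x‖ ≤ M) : ∃ a' : E →L[ℝ] ℝ, HasFDerivAt (fun y => √(q y)) a' x ∧
      ‖a'‖ ≤ M / √q₀ ∧ √q₀ ≤ √(q x) ∧ √(q x) ≤ √M := by
  have h0 : 0 < q x := hq₀.trans_le h1
  have hm : 0 < √q₀ := Real.sqrt_pos.2 hq₀
  have hs : √q₀ ≤ √(q x) := Real.sqrt_le_sqrt h1
  have hs0 : 0 < √(q x) := hm.trans_le hs
  refine ⟨_, hd.hasFDerivAt.sqrt h0.ne', ?_, hs, Real.sqrt_le_sqrt h2⟩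
  rw [norm_smul, Real.norm_eq_abs, abs_of_pos (by positivity)]
  calc 1 / (2 * √(q x)) * ‖fderiv ℝ q x‖ ≤ 1 / √q₀ * M := by
        gcongr
        linarith
    _ = _ := by ring

set_option maxHeartbeats 1600000 in
theorem pw_x {n : ℕ} (lam KA q₀ M : ℝ) (hlam : 0 < lam) (hKA0 : 0 ≤ KA) (hq₀ : 0 < q₀)
    (hM : 0 < M) : ∃ N > 0, ∃ C > 0, ∀ (A : Fin n → Fin n → EuclideanSpace ℝ (Fin n) → ℝ)
    (q qt u ut : EuclideanSpace ℝ (Fin n) → ℝ) (x : EuclideanSpace ℝ (Fin n)),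
    (∀ i j, A i j x = A j i x) → (∀ i j, |A i j x| ≤ KA) →
    (∀ ξ : EuclideanSpace ℝ (Fin n), lam * ‖ξ‖ ^ 2 ≤ ∑ i, ∑ j, A i j x * ξ i * ξ j) →
    q₀ ≤ q x → q₀ ≤ qt x → q x ≤ M → qt x ≤ M → ‖fderiv ℝ q x‖ ≤ M → ‖fderiv ℝ qt x‖ ≤ M →
    |u x| ≤ M → |ut x| ≤ M → ‖fderiv ℝ u x‖ ≤ M → ‖fderiv ℝ ut x‖ ≤ M →
    DifferentiableAt ℝ q x → DifferentiableAt ℝ qt x →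
    DifferentiableAt ℝ u x → DifferentiableAt ℝ ut x →
    DifferentiableAt ℝ (fun y => |u y|) x → DifferentiableAt ℝ (fun y => |ut y|) x →
    ((u x ^ 2 - ut x ^ 2) ^ 2 + ‖fderiv ℝ (fun y => u y ^ 2 - ut y ^ 2) x‖ ^ 2 ≤
      N * (Hfun A qt ut (fun y => 1 - √(qt y) * (√(q y))⁻¹) x -
        Hfun A q u (fun y => (√(q y) * (√(qt y))⁻¹) * (√(q y) * (√(qt y))⁻¹)
          - √(q y) * (√(qt y))⁻¹) x) +
      C * (abs (√(q x) * |u x| - √(qt x) * |ut x|) +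
        ‖fderiv ℝ (fun y => √(q y) * |u y| - √(qt y) * |ut y|) x‖)) ∧
    abs (√(q x) * |u x| - √(qt x) * |ut x|) ≤ C ∧
    ‖fderiv ℝ (fun y => √(q y) * |u y| - √(qt y) * |ut y|) x‖ ≤ C := by
  obtain ⟨m, hm⟩ : ∃ m, m = √q₀ := ⟨_, rfl⟩
  obtain ⟨P, hP⟩ : ∃ P, P = √M := ⟨_, rfl⟩
  have hm0 : 0 < m := hm ▸ Real.sqrt_pos.2 hq₀
  have hP0 : 0 < P := hP ▸ Real.sqrt_pos.2 hM
  obtain ⟨K, hK⟩ : ∃ K, K = 1 + M + n * n * KA + P / m + 1 / q₀ + 1 / m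
    + (1 / m) * (M / m + (P / m) * (M / m)) + (M / m) / m := ⟨_, rfl⟩
  have k1 : 0 ≤ n * n * KA := by positivity
  have k2 : 0 ≤ P / m := by positivity
  have k3 : 0 ≤ 1 / q₀ := by positivity
  have k4 : 0 ≤ 1 / m := by positivity
  have k5 : 0 ≤ (1 / m) * (M / m + (P / m) * (M / m)) := by positivity
  have k6 : 0 ≤ (M / m) / m := by positivity
  have hK1 : 1 ≤ K := by linarith
  have hK0 : 0 ≤ K := by linarith
  obtain ⟨N, hN, C, hC, H⟩ := pw_main (V := EuclideanSpace ℝ (Fin n) →L[ℝ] ℝ) lam K hlam hK1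
  refine ⟨N, hN, C * (K + K + K * K) + 2 * (P * M + M * (M / m)), by positivity, ?_⟩
  intro A q qt u ut x hs hb hc hq1 hqt1 hq2 hqt2 hq' hqt' hu hut hu' hut' dq dqt du dut dau daut
  obtain ⟨a', ha', ha1, ha2, ha3⟩ := sqrt_bd hq₀ hM hq1 hq2 dq hq'
  obtain ⟨b', hb', hb1, hb2, hb3⟩ := sqrt_bd hq₀ hM hqt1 hqt2 dqt hqt'
  obtain ⟨s, hss, hs1, hs2⟩ := abs_deriv_sign du dau
  obtain ⟨t, htt, ht1, ht2⟩ := abs_deriv_sign dut daut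
  rw [← hm] at ha1 ha2 hb1 hb2
  rw [← hP] at ha3 hb3
  set a := √(q x) with ha
  set b := √(qt x) with hbdef
  have ha0 : 0 < a := by linarith
  have hb0 : 0 < b := by linarith
  have haa : a * a = q x := Real.mul_self_sqrt (by linarith)
  have hbb : b * b = qt x := Real.mul_self_sqrt (by linarith)
  set U := |u x| with hU
  set Ut := |ut x| with hUt
  set U' := fderiv ℝ (fun y => |u y|) x with hU'
  set Ut' := fderiv ℝ (fun y => |ut y|) x with hUt'
  have abs1 : ∀ s : ℝ, s * s = 1 → |s| = 1 := by
    intro s hs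
    rcases mul_self_eq_one_iff.1 hs with h | h <;> simp [h]
  have nU' : ‖U'‖ ≤ M := by rw [hs2, norm_smul, Real.norm_eq_abs, abs1 s hss, one_mul]; exact hu'
  have nUt' : ‖Ut'‖ ≤ M := by rw [ht2, norm_smul, Real.norm_eq_abs, abs1 t htt, one_mul]; exact hut'
  set r := a * b⁻¹ with hr
  set k := b * a⁻¹ with hk
  have hkr : k * r = 1 := by rw [hk, hr]; field_simp
  set r' := b⁻¹ • (a' - r • b') with hr'
  have dr : HasFDerivAt (fun y => √(q y) * (√(qt y))⁻¹) r' x := d_ratio ha' hb' hb0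
  have dk : HasFDerivAt (fun y => 1 - √(qt y) * (√(q y))⁻¹) (k ^ 2 • r') x :=
    d_ratio2 ha' hb' hb0 ha0
  have dη : HasFDerivAt (fun y => (√(q y) * (√(qt y))⁻¹) * (√(q y) * (√(qt y))⁻¹)
          - √(q y) * (√(qt y))⁻¹) ((2 * r - 1) • r') x := d_sq dr
  have dD : HasFDerivAt (fun y => √(q y) * |u y| - √(qt y) * |ut y|)
      ((a • U' + U • a') - (b • Ut' + Ut • b')) x :=
    (ha'.mul dau.hasFDerivAt).sub (hb'.mul daut.hasFDerivAt)
  have dw : fderiv ℝ (fun y => u y ^ 2 - ut y ^ 2) x = (2 * U) • U' - (2 * Ut) • Ut' := by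
    have h1 := (du.hasFDerivAt.pow 2).sub (dut.hasFDerivAt.pow 2)
    have h2 := h1.fderiv
    refine Eq.trans h2 ?_
    rw [hs1, hs2, ht1, ht2]
    ext v
    simp
    linear_combination (-2 * u x * fderiv ℝ u x v) * hss + (2 * ut x * fderiv ℝ ut x v) * htt
  have usq : u x ^ 2 = U ^ 2 := (sq_abs _).symm
  have utsq : ut x ^ 2 = Ut ^ 2 := (sq_abs _).symm
  have HB : ∀ (s c w : ℝ) (l m : EuclideanSpace ℝ (Fin n) →L[ℝ] ℝ), s * s = 1 →
      Bform A x (w • l + c • m) m = Bform A x ((s * w) • l + c • (s • m)) (s • m) := by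
    intro s c w l m h
    simp only [map_add, map_smul, LinearMap.add_apply, LinearMap.smul_apply, smul_eq_mul]
    linear_combination (-(w * Bform A x l m) - c * Bform A x m m) * h
  have H1 : Hfun A qt ut (fun y => 1 - √(qt y) * (√(q y))⁻¹) x =
      Bform A x (Ut • (k ^ 2 • r') + (1 - k) • Ut') Ut' - qt x * Ut ^ 2 * (1 - k) := by
    rw [Hfun_eq, dk.fderiv, utsq, HB t _ _ _ _ htt, ← ht1, ← ht2]
  have H2 : Hfun A q u (fun y => (√(q y) * (√(qt y))⁻¹) * (√(q y) * (√(qt y))⁻¹)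
          - √(q y) * (√(qt y))⁻¹) x =
      Bform A x (U • ((2 * r - 1) • r') + (r ^ 2 - r) • U') U'
        - (r ^ 2 * qt x) * U ^ 2 * (r ^ 2 - r) := by
    rw [Hfun_eq, dη.fderiv, usq, HB s _ _ _ _ hss, ← hs1, ← hs2]
    have e1 : r ^ 2 * qt x = q x := by
      rw [← hbb, ← haa, hr]; field_simp
    have e2 : √(q x) * (√(qt x))⁻¹ = r := rfl
    rw [e1, e2, sq r]
  have hrP : r ≤ P / m := by
    rw [hr, ← div_eq_mul_inv]; gcongr
  have hkP : k ≤ P / m := by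
    rw [hk, ← div_eq_mul_inv]; gcongr
  have hr0 : 0 ≤ r := by positivity
  have hk0 : 0 ≤ k := by positivity
  have hbi : b⁻¹ ≤ 1 / m := by rw [one_div]; exact inv_anti₀ hm0 hb2
  have nr' : ‖r'‖ ≤ K := by
    rw [hr', norm_smul, Real.norm_eq_abs, abs_of_pos (by positivity)]
    have : ‖a' - r • b'‖ ≤ M / m + (P / m) * (M / m) := by
      refine (norm_sub_le _ _).trans ?_
      rw [norm_smul, Real.norm_eq_abs, abs_of_nonneg hr0]
      gcongr
    calc b⁻¹ * ‖a' - r • b'‖ ≤ (1 / m) * (M / m + (P / m) * (M / m)) := by gcongr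
      _ ≤ K := by linarith
  have U0 : |U| = U := abs_abs _
  have Ut0 : |Ut| = Ut := abs_abs _
  have key := H (Bform A x) U Ut r k (qt x) U' Ut' r' (Bform_symm A x hs)
    (by
      intro l m
      refine (Bform_bound A x KA hb hKA0 l m).trans ?_
      gcongr
      linarith)
    (Bform_coercive A x lam hlam hc) hkr hr0 (by linarith)
    (by rw [abs_of_nonneg hk0]; linarith)
    (by rw [abs_of_nonneg (by linarith)]; linarith)
    (by
      calc 1 = (1 / q₀) * q₀ := by field_simp
        _ ≤ K * qt x := by gcongr; linarith)
    (by rw [U0]; linarith) (by rw [Ut0]; linarith) (by linarith) (by linarith) nr'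
  have De : Ut - r * U = - (b⁻¹ * (a * U - b * Ut)) := by rw [hr]; field_simp; ring
  set D' := (a • U' + U • a') - (b • Ut' + Ut • b') with hD'
  have De' : Ut' - r • U' - U • r' = -(b⁻¹ • D') - (b⁻¹ * (Ut - r * U)) • b' :=
    De_alg a b U Ut hb0.ne' a' b' U' Ut'
  have be : |Ut - r * U| ≤ K * |a * U - b * Ut| := by
    rw [De, abs_neg, abs_mul, abs_of_pos (by positivity : 0 < b⁻¹)]
    gcongr
    linarith
  have hbb' : b⁻¹ * ‖b'‖ ≤ K := by
    calc b⁻¹ * ‖b'‖ ≤ (1 / m) * (M / m) := by gcongr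
      _ = (M / m) / m := by ring
      _ ≤ K := by linarith
  have be' : ‖Ut' - r • U' - U • r'‖ ≤ K * ‖D'‖ + K * K * |a * U - b * Ut| := by
    rw [De']
    refine (norm_sub_le _ _).trans ?_
    rw [norm_neg, norm_smul, norm_smul, norm_mul]
    simp only [Real.norm_eq_abs]
    rw [abs_of_pos (by positivity : 0 < b⁻¹)]
    refine add_le_add ?_ ?_
    · gcongr
      linarith
    · calc b⁻¹ * |Ut - r * U| * ‖b'‖ = (b⁻¹ * ‖b'‖) * |Ut - r * U| := by ring
        _ ≤ K * (K * |a * U - b * Ut|) := by gcongr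
        _ = _ := by ring
  have Dab : |a * U - b * Ut| ≤ 2 * (P * M + M * (M / m)) := by
    refine (abs_sub _ _).trans ?_
    rw [abs_mul, abs_mul, U0, Ut0, abs_of_pos ha0, abs_of_pos hb0]
    have h1 : a * U ≤ P * M := by gcongr
    have h2 : b * Ut ≤ P * M := by gcongr
    have h3 : 0 ≤ M * (M / m) := by positivity
    linarith
  have Dab' : ‖D'‖ ≤ 2 * (P * M + M * (M / m)) := by
    refine (norm_sub_le _ _).trans ?_
    have h1 := norm_add_le (a • U') (U • a')
    have h2 := norm_add_le (b • Ut') (Ut • b')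
    simp only [norm_smul, Real.norm_eq_abs, U0, Ut0, abs_of_pos ha0, abs_of_pos hb0] at h1 h2
    have h3 : a * ‖U'‖ ≤ P * M := by gcongr
    have h4 : b * ‖Ut'‖ ≤ P * M := by gcongr
    have h5 : U * ‖a'‖ ≤ M * (M / m) := by gcongr
    have h6 : Ut * ‖b'‖ ≤ M * (M / m) := by gcongr
    linarith
  have hCK : 0 ≤ C * (K + K + K * K) := by positivity
  have hPM : 0 ≤ 2 * (P * M + M * (M / m)) := by positivity
  rw [dD.fderiv, dw, H1, H2, usq, utsq]
  refine ⟨key.trans ?_, Dab.trans (by linarith), Dab'.trans (by linarith)⟩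
  refine add_le_add le_rfl ?_
  have z1 : 0 ≤ |a * U - b * Ut| := abs_nonneg _
  have z2 : 0 ≤ ‖D'‖ := norm_nonneg _
  calc C * (|Ut - r * U| + ‖Ut' - r • U' - U • r'‖)
      ≤ C * (K * |a * U - b * Ut| + (K * ‖D'‖ + K * K * |a * U - b * Ut|)) := by gcongr
    _ ≤ C * ((K + K + K * K) * (|a * U - b * Ut| + ‖D'‖)) := by
        gcongr
        have y1 : 0 ≤ K * |a * U - b * Ut| := by positivity
        have y2 : 0 ≤ K * ‖D'‖ := by positivity
        have y3 : 0 ≤ K * K * ‖D'‖ := by positivity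
        linarith
    _ ≤ (C * (K + K + K * K) + 2 * (P * M + M * (M / m))) * (|a * U - b * Ut| + ‖D'‖) := by
        have y : 0 ≤ 2 * (P * M + M * (M / m)) * (|a * U - b * Ut| + ‖D'‖) := by positivity
        linarith

/-- The abstract final integration step. -/
theorem final_int {α : Type*} [MeasurableSpace α] {μ : Measure α} [IsFiniteMeasure μ]
    (W D D' G : α → ℝ) (C : ℝ) (hC : 0 < C)
    (hW0 : ∀ x, 0 ≤ W x) (hG : Integrable G μ) (hGi : ∫ x, G x ∂μ = 0)
    (hI : Integrable (fun x => D x ^ 2 + D' x ^ 2) μ)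
    (hle : ∀ᵐ x ∂μ, W x ≤ G x + C * (|D x| + |D' x|)) :
    ∫ x, W x ∂μ ≤ (C * (μ.real univ + 1)) * √(∫ x, D x ^ 2 + D' x ^ 2 ∂μ) := by
  set I := ∫ x, D x ^ 2 + D' x ^ 2 ∂μ with hIdef
  have hI0 : 0 ≤ I := integral_nonneg fun x => by positivity
  have key : ∀ τ > 0, ∫ x, W x ∂μ ≤ C * (τ * μ.real univ + I / τ) := by
    intro τ hτ
    have hgint' : Integrable (fun x => C * τ + (C / τ) * (D x ^ 2 + D' x ^ 2)) μ :=
      (integrable_const _).add (hI.const_mul _)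
    have hgint : Integrable (fun x => G x + (C * τ + (C / τ) * (D x ^ 2 + D' x ^ 2))) μ :=
      hG.add hgint'
    have h1 : ∫ x, W x ∂μ ≤ ∫ x, (G x + (C * τ + (C / τ) * (D x ^ 2 + D' x ^ 2))) ∂μ := by
      refine integral_mono_of_nonneg (Filter.Eventually.of_forall hW0) hgint ?_
      filter_upwards [hle] with x hx
      refine hx.trans ?_
      have e : ∀ d : ℝ, |d| ≤ τ / 2 + d ^ 2 / τ := by
        intro d
        rw [div_add_div _ _ two_ne_zero hτ.ne', le_div_iff₀ (by positivity)]
        nlinarith [sq_nonneg (τ - |d|), sq_abs d, sq_nonneg d]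
      have e1 := e (D x)
      have e2 := e (D' x)
      have e3 : C * (|D x| + |D' x|) ≤ C * (τ + (D x ^ 2 / τ + D' x ^ 2 / τ)) := by
        refine mul_le_mul_of_nonneg_left ?_ hC.le
        linarith
      have e4 : C * (τ + (D x ^ 2 / τ + D' x ^ 2 / τ)) = C * τ + (C / τ) * (D x ^ 2 + D' x ^ 2) := by
        field_simp
      linarith
    refine h1.trans (le_of_eq ?_)
    rw [integral_add hG hgint', hGi,
      integral_add (integrable_const _) (hI.const_mul _), integral_const_mul (C / τ), ← hIdef]
    simp only [integral_const, smul_eq_mul]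
    field_simp
    ring
  rcases hI0.eq_or_lt with h | h
  · rw [← h, Real.sqrt_zero, mul_zero]
    refine le_of_forall_pos_le_add fun ε hε => ?_
    have hv : 0 ≤ μ.real univ := measureReal_nonneg
    have := key (ε / (C * (μ.real univ + 1))) (by positivity)
    rw [← h, zero_div, add_zero] at this
    refine this.trans ?_
    rw [zero_add, ← mul_assoc, mul_div_assoc', div_mul_eq_mul_div, div_le_iff₀ (by positivity)]
    nlinarith [mul_pos hC hε]
  · have hs : 0 < √I := Real.sqrt_pos.2 h
    have := key (√I) hs
    rw [Real.div_sqrt] at this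
    refine this.trans (le_of_eq ?_)
    ring

theorem stmt_4 {n : ℕ} (hn : n = 2 ∨ n = 3)
    (Ω : Set (EuclideanSpace ℝ (Fin n)))
    (hΩo : IsOpen Ω) (hΩb : Bornology.IsBounded Ω) (hΩc : IsConnected Ω)
    (hΩreg : IsC11Boundary Ω)
    (A : Fin n → Fin n → EuclideanSpace ℝ (Fin n) → ℝ) (hA : EllipticSym Ω A)
    (q₀ M : ℝ) (hq₀ : 0 < q₀) (hM : 0 < M) :
    ∃ C > 0, ∀ q qt u ut : EuclideanSpace ℝ (Fin n) → ℝ,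
      W1InfBound Ω q M → W1InfBound Ω qt M →
      (∀ x ∈ closure Ω, q₀ ≤ q x) → (∀ x ∈ closure Ω, q₀ ≤ qt x) →
      (∀ x ∈ frontier Ω, q x = qt x) →
      ContDiffOn ℝ 2 u Ω → ContDiffOn ℝ 1 u (closure Ω) →
      ContDiffOn ℝ 2 ut Ω → ContDiffOn ℝ 1 ut (closure Ω) →
      IsSolution A q u Ω → IsSolution A qt ut Ω →
      (∀ x ∈ frontier Ω, u x = ut x) →
      (∀ x ∈ closure Ω, |u x| ≤ M) → (∀ x ∈ Ω, ‖fderiv ℝ u x‖ ≤ M) →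
      (∀ x ∈ closure Ω, |ut x| ≤ M) → (∀ x ∈ Ω, ‖fderiv ℝ ut x‖ ≤ M) →
      H1Norm Ω (fun x => (u x) ^ 2 - (ut x) ^ 2) ≤
        C * (H1Norm Ω
          (fun x => Real.sqrt (q x) * |u x| - Real.sqrt (qt x) * |ut x|)) ^ (1 / 2 : ℝ) := by
  
  have hne : Nonempty (Fin n) := ⟨⟨0, by omega⟩⟩
  have hcΩ : Ωᶜ.Nonempty := by
    rw [Set.nonempty_compl]
    rintro rfl
    exact NormedSpace.unbounded_univ ℝ (EuclideanSpace ℝ (Fin n)) hΩb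
  have hsub : Ω ⊆ closure Ω := subset_closure
  have hcpt : IsCompact (closure Ω) := hΩb.isCompact_closure
  obtain ⟨hAs, hAc, lam, hlam, hAe⟩ := hA
  have hKex : ∀ i j, ∃ K : ℝ, ∀ x ∈ closure Ω, ‖A i j x‖ ≤ K := fun i j =>
    hcpt.exists_bound_of_continuousOn (hAc i j).continuousOn
  choose K0 hK0 using hKex
  obtain ⟨KA, hKAdef⟩ : ∃ KA, KA = ∑ i, ∑ j, |K0 i j| := ⟨_, rfl⟩
  have hKA0 : 0 ≤ KA := hKAdef ▸ by positivity
  have hKA : ∀ x ∈ Ω, ∀ i j, |A i j x| ≤ KA := by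
    intro x hx i j
    have h1 : |A i j x| ≤ |K0 i j| := (hK0 i j x (hsub hx)).trans (le_abs_self _)
    have h2 : |K0 i j| ≤ ∑ j, |K0 i j| :=
      Finset.single_le_sum (f := fun j => |K0 i j|) (fun _ _ => abs_nonneg _) (Finset.mem_univ j)
    have h3 : ∑ j, |K0 i j| ≤ ∑ i, ∑ j, |K0 i j| :=
      Finset.single_le_sum (f := fun i => ∑ j, |K0 i j|)
        (fun _ _ => Finset.sum_nonneg fun _ _ => abs_nonneg _) (Finset.mem_univ i)
    rw [hKAdef]
    linarith
  obtain ⟨N, hN, C, hC, H⟩ := pw_x (n := n) lam KA q₀ M hlam hKA0 hq₀ hM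
  have : IsFiniteMeasure (volume.restrict Ω) := ⟨by simpa using hΩb.measure_lt_top⟩
  obtain ⟨C₁, hC₁def⟩ : ∃ C₁, C₁ = C * ((volume.restrict Ω).real univ + 1) := ⟨_, rfl⟩
  have hC₁ : 0 < C₁ := by rw [hC₁def]; positivity
  refine ⟨√C₁, Real.sqrt_pos.2 hC₁, ?_⟩
  intro q qt u ut hq hqt hq0 hqt0 hqq hu2 hu1 hut2 hut1 hsu hsut _ huM huM' hutM hutM'
  have W1 : ∀ f, W1InfBound Ω f M → (∀ x ∈ closure Ω, |f x| ≤ M) ∧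
      (∀ x ∈ Ω, ‖fderiv ℝ f x‖ ≤ M) ∧ ContinuousOn f (closure Ω) ∧
      ∀ᵐ x ∂(volume.restrict Ω), DifferentiableAt ℝ f x := by
    rintro f ⟨L, hL, hb⟩
    refine ⟨fun x hx => ?_, fun x hx => ?_, hL.continuousOn, ae_diff_of_lipOn hΩo (hL.mono hsub)⟩
    · have := hb x hx
      have := L.2
      linarith
    · have h1 := norm_fderiv_le_of_lipschitzOn ℝ
        (Filter.mem_of_superset (hΩo.mem_nhds hx) hsub) hL
      have := hb x (hsub hx)
      have := abs_nonneg (f x)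
      linarith
  obtain ⟨hqM, hqM', hqc, hqd⟩ := W1 q hq
  obtain ⟨hqtM, hqtM', hqtc, hqtd⟩ := W1 qt hqt
  have hm0 : 0 < √q₀ := Real.sqrt_pos.2 hq₀
  have la : LB (closure Ω) (fun x => √(q x)) := (LB.of_W1 hM.le hq).sqrt hq₀ hq0
  have lb : LB (closure Ω) (fun x => √(qt x)) := (LB.of_W1 hM.le hqt).sqrt hq₀ hqt0
  have lai := la.inv hm0 (fun x hx => Real.sqrt_le_sqrt (hq0 x hx))
  have lbi := lb.inv hm0 (fun x hx => Real.sqrt_le_sqrt (hqt0 x hx))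
  have lr := la.mul lbi
  obtain ⟨L1, hL1⟩ := ((lr.mul lr).sub lr).lip
  obtain ⟨L2, hL2⟩ := ((LB.const 1).sub (lb.mul lai)).lip
  have hz : ∀ x ∈ frontier Ω, √(q x) * (√(qt x))⁻¹ = 1 ∧ √(qt x) * (√(q x))⁻¹ = 1 := by
    intro x hx
    have h1 : 0 < √(q x) :=
      Real.sqrt_pos.2 (hq₀.trans_le (hq0 x (frontier_subset_closure hx)))
    rw [← hqq x hx]
    exact ⟨mul_inv_cancel₀ h1.ne', mul_inv_cancel₀ h1.ne'⟩
  have hAc' : ∀ i j, ContDiffOn ℝ 1 (A i j) Ω := fun i j => (hAc i j).mono hsub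
  obtain ⟨i1, e1⟩ := wf_on hΩo hΩb hcΩ hL1 (fun x hx => by simp [(hz x hx).1]) A q u KA M hKA0 hM.le
    hAc' hKA hu2 (fun x hx => huM x (hsub hx)) huM' (hqc.mono hsub)
    (fun x hx => hqM x (hsub hx)) hsu
  obtain ⟨i2, e2⟩ := wf_on hΩo hΩb hcΩ hL2 (fun x hx => by simp [(hz x hx).2]) A qt ut KA M hKA0 hM.le
    hAc' hKA hut2 (fun x hx => hutM x (hsub hx)) hutM' (hqtc.mono hsub)
    (fun x hx => hqtM x (hsub hx)) hsut
  have hud : ∀ x ∈ Ω, DifferentiableAt ℝ u x := fun x hx =>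
    (hu2.differentiableOn (by norm_num)).differentiableAt (hΩo.mem_nhds hx)
  have hutd : ∀ x ∈ Ω, DifferentiableAt ℝ ut x := fun x hx =>
    (hut2.differentiableOn (by norm_num)).differentiableAt (hΩo.mem_nhds hx)
  have hpw := (ae_restrict_mem (μ := volume) hΩo.measurableSet)
  have hpt : ∀ᵐ x ∂(volume.restrict Ω),
      ((u x ^ 2 - ut x ^ 2) ^ 2 + ‖fderiv ℝ (fun y => u y ^ 2 - ut y ^ 2) x‖ ^ 2 ≤
      N * (Hfun A qt ut (fun y => 1 - √(qt y) * (√(q y))⁻¹) x -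
        Hfun A q u (fun y => (√(q y) * (√(qt y))⁻¹) * (√(q y) * (√(qt y))⁻¹)
          - √(q y) * (√(qt y))⁻¹) x) +
      C * (abs (√(q x) * |u x| - √(qt x) * |ut x|) +
        ‖fderiv ℝ (fun y => √(q y) * |u y| - √(qt y) * |ut y|) x‖)) ∧
      abs (√(q x) * |u x| - √(qt x) * |ut x|) ≤ C ∧
      ‖fderiv ℝ (fun y => √(q y) * |u y| - √(qt y) * |ut y|) x‖ ≤ C := by
    filter_upwards [hpw, hqd, hqtd, ae_diff_abs hΩo (hu1.mono hsub), ae_diff_abs hΩo (hut1.mono hsub)]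
      with x hx d1 d2 d3 d4
    have hxc := hsub hx
    exact H A q qt u ut x (fun i j => hAs i j x hxc) (hKA x hx) (hAe x hx) (hq0 x hxc) (hqt0 x hxc)
      ((le_abs_self _).trans (hqM x hxc)) ((le_abs_self _).trans (hqtM x hxc)) (hqM' x hx)
      (hqtM' x hx) (huM x hxc) (hutM x hxc) (huM' x hx) (hutM' x hx) d1 d2 (hud x hx) (hutd x hx)
      d3 d4
  have hDc : ContinuousOn (fun x => √(q x) * |u x| - √(qt x) * |ut x|) Ω :=
    ((hqc.mono hsub).sqrt.mul (hu2.continuousOn.abs)).sub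
      ((hqtc.mono hsub).sqrt.mul (hut2.continuousOn.abs))
  have hI : Integrable (fun x => (√(q x) * |u x| - √(qt x) * |ut x|) ^ 2 +
      ‖fderiv ℝ (fun y => √(q y) * |u y| - √(qt y) * |ut y|) x‖ ^ 2) (volume.restrict Ω) := by
    refine Integrable.of_bound (C := C ^ 2 + C ^ 2) ?_ ?_
    · refine ((hDc.aestronglyMeasurable hΩo.measurableSet).pow 2).add ?_
      exact ((measurable_fderiv ℝ _).norm.pow_const 2).aestronglyMeasurable
    · filter_upwards [hpt] with x hx
      obtain ⟨-, h1, h2⟩ := hx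
      rw [Real.norm_eq_abs, abs_of_nonneg (by positivity), ← sq_abs (√(q x) * |u x| - _)]
      gcongr
  have fin := final_int (μ := volume.restrict Ω)
    (fun x => (u x ^ 2 - ut x ^ 2) ^ 2 + ‖fderiv ℝ (fun y => u y ^ 2 - ut y ^ 2) x‖ ^ 2)
    (fun x => √(q x) * |u x| - √(qt x) * |ut x|)
    (fun x => ‖fderiv ℝ (fun y => √(q y) * |u y| - √(qt y) * |ut y|) x‖)
    (fun x => N * (Hfun A qt ut (fun y => 1 - √(qt y) * (√(q y))⁻¹) x -
        Hfun A q u (fun y => (√(q y) * (√(qt y))⁻¹) * (√(q y) * (√(qt y))⁻¹)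
          - √(q y) * (√(qt y))⁻¹) x)) C hC
    (fun x => by positivity) ((i2.sub i1).const_mul N)
    (by rw [integral_const_mul, integral_sub i2 i1, e1, e2]; simp) hI
    (by
      filter_upwards [hpt] with x hx
      rw [abs_of_nonneg (norm_nonneg (fderiv ℝ (fun y => √(q y) * |u y| - √(qt y) * |ut y|) x))]
      exact hx.1)
  rw [← hC₁def] at fin
  unfold H1Norm
  rw [← Real.sqrt_eq_rpow, ← Real.sqrt_eq_rpow, ← Real.sqrt_eq_rpow, ← Real.sqrt_mul hC₁.le]
  exact Real.sqrt_le_sqrt fin
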